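/- Fix an integer n ≥ 2 and a splitting type r, and set C_{k,r} = δ(r)^{(k−1)/2}·k!/(2^{(k−1)/2}((k−1)/2)!) for odd k. Let x = N^{1/log log N}. There exist constants c, C > 0 depending only on n and r such that for all sufficiently large N and all odd natural numbers k with k ≤ c·log log N, one has | 𝔼_N( (π_{f,r}(x) − δ(r)π(x))^k ) | ≤ C·C_{k,r}·π(x)^{k/2}·k·(log log x)/π(x)^{1/2}. -/

import Mathlib

/-!
Arithmetic statistics of families of integer `S_n`-polynomials (I. Viglino).

`𝒫_{n,N}` is the family of monic integer polynomials
`f(X) = X^n + a_{n-1}X^{n-1} + ⋯ + a_0` with `|a_i| ≤ N`, identified with their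
coefficient vectors `a : Fin n → ℤ`, and `𝒫⁰_{n,N} ⊆ 𝒫_{n,N}` is the subfamily of
`f` whose splitting field over `ℚ` has Galois group isomorphic to `S_n`.
-/

open Polynomial Finset Filter

attribute [local instance] Classical.propDecidable

noncomputable section

/-- The monic integer polynomial `X^n + a_{n-1}X^{n-1} + ⋯ + a_0`. -/
def intPoly (n : ℕ) (a : Fin n → ℤ) : Polynomial ℤ :=
  Polynomial.X ^ n + ∑ i : Fin n, Polynomial.C (a i) * Polynomial.X ^ (i : ℕ)

/-- The same polynomial viewed over `ℚ`. -/
def ratPoly (n : ℕ) (a : Fin n → ℤ) : Polynomial ℚ :=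
  (intPoly n a).map (Int.castRingHom ℚ)

/-- Coefficient vectors with entries in `{-N, …, N}`: the family `𝒫_{n,N}`. -/
def coeffBox (n N : ℕ) : Finset (Fin n → ℤ) :=
  Fintype.piFinset fun _ => Finset.Icc (-(N : ℤ)) (N : ℤ)

/-- `f` is an `S_n`-polynomial: the Galois group of its splitting field `K_f` over `ℚ`
is isomorphic to the symmetric group on `n` letters. -/
def IsSnPoly (n : ℕ) (a : Fin n → ℤ) : Prop :=
  Nonempty ((ratPoly n a).Gal ≃* Equiv.Perm (Fin n))

/-- The family `𝒫⁰_{n,N}` of `S_n`-polynomials, as a finset of coefficient vectors. -/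
def P0 (n N : ℕ) : Finset (Fin n → ℤ) :=
  (coeffBox n N).filter fun a => IsSnPoly n a

/-- `ℙ_N`, the uniform probability of an event in `𝒫⁰_{n,N}`. -/
def probN (n N : ℕ) (E : (Fin n → ℤ) → Prop) : ℝ :=
  (((P0 n N).filter E).card : ℝ) / ((P0 n N).card : ℝ)

/-- `𝔼_N`, the expectation of a real random variable on `𝒫⁰_{n,N}`. -/
def expN (n N : ℕ) (F : (Fin n → ℤ) → ℝ) : ℝ :=
  (∑ a ∈ P0 n N, F a) / ((P0 n N).card : ℝ)

/-- `π(x)`, the number of rational primes `≤ x`. -/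
def primePi (x : ℝ) : ℕ :=
  ((Finset.range (⌊x⌋₊ + 1)).filter Nat.Prime).card

/-- `g ∈ 𝔽_p[X]` has splitting type `r = (r_1, …, r_n)` — encoded by `r : Fin n → ℕ` where
`r i` is `r_{i+1}`, the number of factors of degree `i+1` —, i.e. `g` is a product of
distinct monic irreducible polynomials with exactly `r i` monic irreducible factors of
degree `i+1` for each `i`. -/
def SplitTypeOf {p : ℕ} (g : Polynomial (ZMod p)) {n : ℕ} (r : Fin n → ℕ) : Prop :=
  Squarefree g ∧ ∀ i : Fin n,
    Nat.card {h : Polynomial (ZMod p) // h.Monic ∧ Irreducible h ∧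
      h.natDegree = (i : ℕ) + 1 ∧ h ∣ g} = r i

/-- `f` has splitting type `r` modulo `p`. -/
def HasSplitType (n : ℕ) (r : Fin n → ℕ) (a : Fin n → ℤ) (p : ℕ) : Prop :=
  SplitTypeOf ((intPoly n a).map (Int.castRingHom (ZMod p))) r

/-- `π_{f,r}(x)`: the number of primes `p ≤ x` such that `f` has splitting type `r` mod `p`. -/
def countSplit (n : ℕ) (r : Fin n → ℕ) (a : Fin n → ℤ) (x : ℝ) : ℕ :=
  ((Finset.range (⌊x⌋₊ + 1)).filter fun p => p.Prime ∧ HasSplitType n r a p).card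

/-- `δ(r) = ∏_{i=1}^n 1/(i^{r_i}·r_i!)`. -/
def splitDelta (n : ℕ) (r : Fin n → ℕ) : ℝ :=
  ∏ i : Fin n, (1 : ℝ) / ((((i : ℕ) + 1) ^ (r i) * Nat.factorial (r i) : ℕ) : ℝ)

/-- `r_i` as a function of the index `i ≥ 1` (so `rget n r 1 = r_1`, etc.). -/
def rget (n : ℕ) (r : Fin n → ℕ) (i : ℕ) : ℕ :=
  if h : i - 1 < n then r ⟨i - 1, h⟩ else 0

/-- `C_r = δ(r)·r_2(r_2−1)(r_1+1)(r_1+2)/(2^{r_2+1}·r_1!·r_2!)`. -/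
def splitCr (n : ℕ) (r : Fin n → ℕ) : ℝ :=
  splitDelta n r *
    ((rget n r 2 : ℝ) * ((rget n r 2 : ℝ) - 1) *
      ((rget n r 1 : ℝ) + 1) * ((rget n r 1 : ℝ) + 2)) /
    ((2 : ℝ) ^ (rget n r 2 + 1) * (Nat.factorial (rget n r 1) : ℝ) *
      (Nat.factorial (rget n r 2) : ℝ))

/-- `C_{k,r} = δ(r)^{(k−1)/2}·k!/(2^{(k−1)/2}((k−1)/2)!)` for odd `k`. -/
def CkrOdd (n : ℕ) (r : Fin n → ℕ) (k : ℕ) : ℝ :=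
  splitDelta n r ^ ((k - 1) / 2) * (Nat.factorial k : ℝ) /
    ((2 : ℝ) ^ ((k - 1) / 2) * (Nat.factorial ((k - 1) / 2) : ℝ))

/-- The Taylor coefficients of `exp (L z + V (exp z - 1 - z))`. -/
def majorant (L V : ℝ) : ℕ → ℝ
  | 0 => 1
  | k + 1 => (L * majorant L V k +
      V * ∑ i : Fin k, majorant L V (k - 1 - i) / (((i : ℕ) + 1).factorial : ℝ)) / (k + 1)
  decreasing_by all_goals omega

lemma majorant_zero (L V : ℝ) : majorant L V 0 = 1 := by rw [majorant]

lemma majorant_succ (L V : ℝ) (k : ℕ) :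
    ((k : ℝ) + 1) * majorant L V (k + 1) = L * majorant L V k +
      V * ∑ i ∈ range k, majorant L V (k - 1 - i) / ((i + 1).factorial : ℝ) := by
  rw [majorant, mul_div_cancel₀ _ (by positivity),
    Fin.sum_univ_eq_sum_range (fun i => majorant L V (k - 1 - i) / ((i + 1).factorial : ℝ))]

lemma majorant_nonneg {L V : ℝ} (hL : 0 ≤ L) (hV : 0 ≤ V) (k : ℕ) : 0 ≤ majorant L V k := by
  induction k using Nat.strong_induction_on with
  | _ k ih =>
    cases k with
    | zero => rw [majorant_zero]; exact zero_le_one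
    | succ k =>
      have h := majorant_succ L V k
      have h1 : 0 ≤ ((k : ℝ) + 1) * majorant L V (k + 1) := by
        rw [h]
        refine add_nonneg (mul_nonneg hL (ih k (by omega)))
          (mul_nonneg hV (sum_nonneg fun i _ => div_nonneg (ih _ (by omega)) (by positivity)))
      exact nonneg_of_mul_nonneg_right h1 (by positivity)

lemma majorant_two (L V : ℝ) : 2 * majorant L V 2 = L ^ 2 + V := by
  have h1 := majorant_succ L V 0
  have h2 := majorant_succ L V 1
  simp [majorant_zero] at h1 h2
  rw [h1] at h2
  linarith [h2, sq L]

lemma sum_div_factorial_le {U : ℝ} (hU : 0 ≤ U) (f : ℕ → ℝ) (s k : ℕ) (hs : 2 ≤ s)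
    (hf : ∀ i < k, f i ≤ U) :
    ∑ i ∈ range k, f i / ((i + s).factorial : ℝ) ≤ U := by
  have key : ∀ i : ℕ, (2 : ℝ) * 2 ^ i ≤ ((i + s).factorial : ℝ) := by
    intro i
    have : 2 ^ (i + 1) ≤ (i + 2).factorial := by
      induction i with
      | zero => simp
      | succ i ih =>
        rw [pow_succ, show i + 1 + 2 = (i + 2) + 1 by ring, Nat.factorial_succ]
        nlinarith
    calc (2 : ℝ) * 2 ^ i = ((2 ^ (i + 1) : ℕ) : ℝ) := by push_cast; ring
      _ ≤ ((i + s).factorial : ℝ) := by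
        exact_mod_cast this.trans (Nat.factorial_le (by omega))
  calc ∑ i ∈ range k, f i / ((i + s).factorial : ℝ)
      ≤ ∑ i ∈ range k, U / 2 * (1 / 2) ^ i := by
        refine sum_le_sum fun i hi => ?_
        calc f i / ((i + s).factorial : ℝ) ≤ U / ((i + s).factorial : ℝ) := by
              gcongr; exact hf i (mem_range.1 hi)
          _ ≤ U / (2 * 2 ^ i) := by gcongr; exact key i
          _ = U / 2 * (1 / 2) ^ i := by rw [one_div, inv_pow]; field_simp
    _ ≤ U := by
      rw [← mul_sum]
      have := geom_sum_eq (by norm_num : (1 / 2 : ℝ) ≠ 1) k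
      rw [this]
      have h0 : (0 : ℝ) ≤ (1 / 2) ^ k := by positivity
      rw [show ((1 / 2 : ℝ) ^ k - 1) / (1 / 2 - 1) = 2 * (1 - (1 / 2) ^ k) by ring]
      nlinarith

/-- The Gaussian moment coefficient `V ^ m / (2 ^ m * m!)`. -/
def gaussCoeff (V : ℝ) (m : ℕ) : ℝ := V ^ m / (2 ^ m * m.factorial)

lemma gaussCoeff_succ (V : ℝ) (m : ℕ) :
    V * gaussCoeff V m = 2 * ((m : ℝ) + 1) * gaussCoeff V (m + 1) := by
  unfold gaussCoeff
  rw [Nat.factorial_succ]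
  push_cast
  rw [pow_succ, pow_succ]
  field_simp

lemma gaussCoeff_nonneg {V : ℝ} (hV : 0 ≤ V) (m : ℕ) : 0 ≤ gaussCoeff V m := by
  unfold gaussCoeff; positivity

lemma gaussCoeff_le {V K : ℝ} (hV : K ≤ V) (hV0 : 0 < V) {i j : ℕ} (hij : i ≤ j) (hj : 2 * j ≤ K) :
    gaussCoeff V i ≤ gaussCoeff V j := by
  induction j, hij using Nat.le_induction with
  | base => exact le_rfl
  | succ j hij ih =>
    refine (ih (by push_cast at hj; linarith)).trans ?_
    have h := gaussCoeff_succ V j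
    have h0 := gaussCoeff_nonneg hV0.le j
    have h1 := gaussCoeff_nonneg hV0.le (j + 1)
    push_cast at hj
    have : V * gaussCoeff V j ≤ V * gaussCoeff V (j + 1) := by rw [h]; nlinarith
    exact le_of_mul_le_mul_left this hV0

set_option maxHeartbeats 1600000 in
lemma majorant_bounds {L V K : ℝ} (hL : 1 ≤ L) (hK : 1 ≤ K) (hV : 6 * K ^ 3 * L ^ 2 ≤ V) (m : ℕ) :
    ((2 * m : ℝ) ≤ K → majorant L V (2 * m) ≤ (1 + m * (6 * K ^ 2 * L ^ 2 / V)) * gaussCoeff V m) ∧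
    ((2 * m + 1 : ℝ) ≤ K →
      majorant L V (2 * m + 1) ≤ 3 * (2 * m + 1) * L * gaussCoeff V m) := by
  have hK3 : K ≤ K ^ 3 := by nlinarith [mul_nonneg (sub_nonneg.2 hK) (sub_nonneg.2 hK)]
  have hK2 : K ^ 2 ≤ K ^ 3 := by nlinarith [sq_nonneg K]
  have hL2 : 1 ≤ L ^ 2 := by nlinarith
  have hLL2 : L ≤ L ^ 2 := by nlinarith
  have hKV : K ≤ V := by nlinarith [mul_le_mul hK3 hL2 (by norm_num) (by positivity)]
  have hV0 : 0 < V := by linarith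
  set η := 6 * K ^ 2 * L ^ 2 / V with hη
  have hη0 : 0 ≤ η := by positivity
  have hηV : η * V = 6 * K ^ 2 * L ^ 2 := by rw [hη]; field_simp
  have hηK : K * η ≤ 1 := by
    rw [hη, mul_div_assoc', div_le_one hV0]; nlinarith
  induction m using Nat.strong_induction_on with
  | _ m ih =>
    have hg := gaussCoeff_nonneg hV0.le
    -- crude bound for all indices below `2 * m`
    have crude : ∀ j M : ℕ, M < m → (2 * m : ℝ) ≤ K → j ≤ 2 * M + 1 →
        majorant L V j ≤ 3 * K * L * gaussCoeff V M := by
      intro j M hM hmK hj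
      have hjm : j / 2 < m := by omega
      obtain ⟨h1, h2⟩ := ih (j / 2) hjm
      have hj2 : ((j / 2 : ℕ) : ℝ) + 1 ≤ m := by exact_mod_cast hjm
      have hle : gaussCoeff V (j / 2) ≤ gaussCoeff V M :=
        gaussCoeff_le hKV hV0 (by omega)
          (by have : (M : ℝ) + 1 ≤ m := by exact_mod_cast hM
              linarith)
      have hgj := hg (j / 2)
      have : majorant L V j ≤ 3 * K * L * gaussCoeff V (j / 2) := by
        rcases Nat.even_or_odd' j with ⟨t, ht | ht⟩
        · have htj : j / 2 = t := by omega
          rw [htj] at h1 hj2 hgj ⊢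
          rw [ht]
          refine (h1 (by linarith)).trans ?_
          gcongr
          have : (t : ℝ) * η ≤ 1 := by nlinarith
          nlinarith
        · have htj : j / 2 = t := by omega
          rw [htj] at h2 hj2 hgj ⊢
          rw [ht]
          refine (h2 (by linarith)).trans ?_
          gcongr
          linarith
      refine this.trans ?_
      gcongr
    rcases m with _ | m
    · constructor
      · intro _; simp [majorant_zero, gaussCoeff]
      · intro _
        have h1 := majorant_succ L V 0
        simp [majorant_zero] at h1
        simp [h1, gaussCoeff]; linarith
    · have hev : (2 * ((m + 1 : ℕ) : ℝ) ≤ K → majorant L V (2 * (m + 1)) ≤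
          (1 + ((m + 1 : ℕ) : ℝ) * η) * gaussCoeff V (m + 1)) := by
        intro hmK
        have hmK' : 2 * ((m : ℝ) + 1) ≤ K := by push_cast at hmK; exact hmK
        have hrec := majorant_succ L V (2 * m + 1)
        rw [sum_range_succ'] at hrec
        have hA := crude (2 * m + 1) m (by omega) hmK (by omega)
        have hB := (ih m (by omega)).1 (by linarith)
        have hC : V * ∑ i ∈ range (2 * m), majorant L V (2 * m + 1 - 1 - (i + 1)) /
            ((i + 1 + 1).factorial : ℝ) ≤ 3 * K * L * K * gaussCoeff V m := by
          rcases m with _ | M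
          · simp; have := hg 0; positivity
          · have := sum_div_factorial_le (U := 3 * K * L * gaussCoeff V M)
              (by have := hg M; positivity)
              (fun i => majorant L V (2 * (M + 1) + 1 - 1 - (i + 1))) 2 (2 * (M + 1)) le_rfl
              (fun i hi => crude _ M (by omega) hmK (by omega))
            have h2 := mul_le_mul_of_nonneg_left this hV0.le
            have h3 : V * (3 * K * L * gaussCoeff V M)
                = 3 * K * L * (2 * ((M : ℝ) + 1)) * gaussCoeff V (M + 1) := by
              rw [show V * (3 * K * L * gaussCoeff V M) = 3 * K * L * (V * gaussCoeff V M) by ring,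
                gaussCoeff_succ]; ring
            rw [h3] at h2
            refine le_trans (by simpa [add_assoc] using h2) ?_
            have := hg (M + 1)
            gcongr
            push_cast at hmK'
            linarith
        simp only [Nat.sub_zero, zero_add, Nat.factorial_one, Nat.cast_one, div_one,
          Nat.add_sub_cancel] at hrec hC
        have hs := gaussCoeff_succ V m
        rw [show 2 * (m + 1) = 2 * m + 1 + 1 by ring]
        push_cast at hrec ⊢
        have hgm := hg m
        have hgm1 := hg (m + 1)
        -- total
        have hA' : L * majorant L V (2 * m + 1) ≤ L * (3 * K * L * gaussCoeff V m) := by gcongr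
        have hB' : V * majorant L V (2 * m) ≤ (1 + m * η) * (V * gaussCoeff V m) := by
          calc V * majorant L V (2 * m) ≤ V * ((1 + m * η) * gaussCoeff V m) := by gcongr
            _ = _ := by ring
        have hE : L * (3 * K * L * gaussCoeff V m) + 3 * K * L * K * gaussCoeff V m ≤
            6 * K ^ 2 * L ^ 2 * gaussCoeff V m := by
          have : L * (3 * K * L) + 3 * K * L * K ≤ 6 * K ^ 2 * L ^ 2 := by
            have a1 : K * L ^ 2 ≤ K ^ 2 * L ^ 2 := by
              have : K ≤ K ^ 2 := by nlinarith
              gcongr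
            have a2 : K ^ 2 * L ≤ K ^ 2 * L ^ 2 := by gcongr
            nlinarith
          calc _ = (L * (3 * K * L) + 3 * K * L * K) * gaussCoeff V m := by ring
            _ ≤ _ := by gcongr
        rw [← hηV, mul_assoc η, hs] at hE
        rw [hs] at hB'
        have hfin : 2 * ((m : ℝ) + 1) * majorant L V (2 * m + 1 + 1) ≤
            2 * ((m : ℝ) + 1) * ((1 + (m + 1) * η) * gaussCoeff V (m + 1)) := by
          have : 2 * ((m : ℝ) + 1) * majorant L V (2 * m + 1 + 1) =
              (2 * m + 1 + 1) * majorant L V (2 * m + 1 + 1) := by ring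
          rw [this, hrec, mul_add]
          nlinarith
        exact le_of_mul_le_mul_left hfin (by positivity)
      refine ⟨hev, fun hmK => ?_⟩
      have hmK0 : 2 * ((m + 1 : ℕ) : ℝ) ≤ K := by linarith
      have hmK' : 2 * ((m : ℝ) + 1) + 1 ≤ K := by push_cast at hmK; exact hmK
      have hrec := majorant_succ L V (2 * (m + 1))
      rw [show 2 * (m + 1) = 2 * m + 1 + 1 by ring, sum_range_succ', sum_range_succ'] at hrec
      have hA := hev hmK0
      have hA2 : majorant L V (2 * (m + 1)) ≤ 2 * gaussCoeff V (m + 1) := by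
        refine hA.trans ?_
        have := hg (m + 1)
        gcongr
        nlinarith
      have hB := (ih m (by omega)).2 (by linarith)
      have hC := (ih m (by omega)).1 (by linarith)
      have hC2 : majorant L V (2 * m) ≤ 2 * gaussCoeff V m := by
        refine hC.trans ?_
        have := hg m
        gcongr
        nlinarith
      have hD : V * ∑ i ∈ range (2 * m), majorant L V (2 * m + 1 + 1 - 1 - (i + 1 + 1)) /
            ((i + 1 + 1 + 1).factorial : ℝ) ≤ L * gaussCoeff V (m + 1) := by
        rcases m with _ | M
        · simp; have := hg 1; positivity
        · have := sum_div_factorial_le (U := 3 * K * L * gaussCoeff V M)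
            (by have := hg M; positivity)
            (fun i => majorant L V (2 * (M + 1) + 1 + 1 - 1 - (i + 1 + 1))) 3 (2 * (M + 1))
            (by norm_num)
            (fun i hi => crude _ M (by omega) hmK0 (by omega))
          have h2 := mul_le_mul_of_nonneg_left this hV0.le
          refine le_trans (by simpa [add_assoc] using h2) ?_
          have s1 := gaussCoeff_succ V M
          have s2 := gaussCoeff_succ V (M + 1)
          have g2 := hg (M + 1 + 1)
          push_cast at hmK' s2
          have : V * (V * (3 * K * L * gaussCoeff V M)) ≤ V * (L * gaussCoeff V (M + 1 + 1)) := by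
            calc V * (V * (3 * K * L * gaussCoeff V M))
                = 3 * K * L * (2 * ((M : ℝ) + 1)) * (V * gaussCoeff V (M + 1)) := by
                  rw [show V * (V * (3 * K * L * gaussCoeff V M))
                    = 3 * K * L * V * (V * gaussCoeff V M) by ring, s1]; ring
              _ = 3 * K * (2 * ((M : ℝ) + 1)) * (2 * (M + 1 + 1)) *
                    (L * gaussCoeff V (M + 1 + 1)) := by rw [s2]; ring
              _ ≤ 3 * K * K * K * (L * gaussCoeff V (M + 1 + 1)) := by
                  gcongr <;> linarith
              _ ≤ V * (L * gaussCoeff V (M + 1 + 1)) := by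
                  gcongr
                  have : (0 : ℝ) ≤ K ^ 3 := by positivity
                  nlinarith
          exact le_of_mul_le_mul_left this hV0
      simp only [Nat.sub_zero, zero_add, Nat.factorial_one, Nat.cast_one, div_one,
          Nat.add_sub_cancel, Nat.factorial_two, one_add_one_eq_two, Nat.cast_ofNat] at hrec hD
      rw [show 2 * m + 1 + 1 = 2 * (m + 1) by ring] at hrec
      have hs := gaussCoeff_succ V m
      have g1 := hg (m + 1)
      have e1 : V * majorant L V (2 * m + 1) ≤
          3 * (2 * m + 1) * L * (2 * (m + 1) * gaussCoeff V (m + 1)) := by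
        rw [← hs]
        calc _ ≤ V * (3 * (2 * m + 1) * L * gaussCoeff V m) := by gcongr
          _ = _ := by ring
      have e2 : V * majorant L V (2 * m) ≤ 2 * (2 * (m + 1) * gaussCoeff V (m + 1)) := by
        rw [← hs]
        calc _ ≤ V * (2 * gaussCoeff V m) := by gcongr
          _ = _ := by ring
      have e3 : L * majorant L V (2 * (m + 1)) ≤ L * (2 * gaussCoeff V (m + 1)) := by gcongr
      have e4 : gaussCoeff V (m + 1) ≤ L * gaussCoeff V (m + 1) := by nlinarith
      push_cast at hrec ⊢
      simp only [Nat.add_sub_add_right] at hrec hD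
      have hfin : (2 * ((m : ℝ) + 1) + 1) * majorant L V (2 * (m + 1) + 1) ≤
            (2 * ((m : ℝ) + 1) + 1) * (3 * (2 * (m + 1) + 1) * L * gaussCoeff V (m + 1)) := by
        rw [hrec]
        have : (0 : ℝ) ≤ m * (L * gaussCoeff V (m + 1)) := by positivity
        have : (0 : ℝ) ≤ L * gaussCoeff V (m + 1) := by positivity
        have e5 : (m : ℝ) * gaussCoeff V (m + 1) ≤ m * (L * gaussCoeff V (m + 1)) := by gcongr
        nlinarith
      exact le_of_mul_le_mul_left hfin (by positivity)

lemma majorant_odd_le {L V K : ℝ} (hL : 1 ≤ L) (hV : 6 * K ^ 3 * L ^ 2 ≤ V) (m : ℕ)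
    (hm : (2 * m + 1 : ℝ) ≤ K) :
    majorant L V (2 * m + 1) ≤ 3 * (2 * m + 1) * L * gaussCoeff V m :=
  (majorant_bounds hL (by linarith [(Nat.cast_nonneg m : (0 : ℝ) ≤ m)]) hV m).2 hm

/-- The exponential generating series of a moment sequence. -/
def momentSeries (μ : ℕ → ℝ) : PowerSeries ℝ := PowerSeries.mk fun j => μ j / (j.factorial : ℝ)

/-- The `k`-th moment of a sum of independent variables with moments `μ p`, `p ∈ T`. -/
def sumMoment (μ : ℕ → ℕ → ℝ) (T : Finset ℕ) (k : ℕ) : ℝ :=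
  ∑ κ ∈ piAntidiag T k, (Nat.multinomial T κ : ℝ) * ∏ p ∈ T, μ p (κ p)

lemma sumMoment_eq (μ : ℕ → ℕ → ℝ) (T : Finset ℕ) (k : ℕ) :
    sumMoment μ T k = (k.factorial : ℝ) *
      PowerSeries.coeff k (∏ p ∈ T, momentSeries (μ p)) := by
  rw [PowerSeries.coeff_prod, sumMoment, mul_sum]
  symm
  refine sum_nbij' (fun l => (l : ℕ → ℕ))
    (fun κ => Finsupp.onFinset (T.filter fun i => κ i ≠ 0) (fun i => if i ∈ T then κ i else 0)
      (by intro a ha; simp at ha ⊢; exact ha)) ?_ ?_ ?_ ?_ ?_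
  · intro l hl
    rw [mem_finsuppAntidiag] at hl
    rw [mem_piAntidiag]
    exact ⟨hl.1, fun i hi => hl.2 (by simpa using hi)⟩
  · intro κ hκ
    rw [mem_piAntidiag] at hκ
    rw [mem_finsuppAntidiag]
    refine ⟨?_, ?_⟩
    · rw [← hκ.1]
      exact sum_congr rfl fun i hi => by simp [hi]
    · intro i hi
      simp at hi
      exact hi.1
  · intro l hl
    rw [mem_finsuppAntidiag] at hl
    ext i
    simp
    intro hi
    by_contra h
    exact hi (hl.2 (by simpa using fun h' => h h'.symm))
  · intro κ hκ
    rw [mem_piAntidiag] at hκ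
    ext i
    simp
    intro hi
    by_contra h
    exact hi (hκ.2 i (fun h' => h h'.symm))
  · intro l hl
    rw [mem_finsuppAntidiag] at hl
    have hs := Nat.multinomial_spec T l
    have hl1 : ∑ i ∈ T, l i = k := hl.1
    rw [hl1] at hs
    rw [← hs]
    simp only [momentSeries, PowerSeries.coeff_mk, prod_div_distrib]
    have : (∏ i ∈ T, ((l i).factorial : ℝ)) ≠ 0 :=
      prod_ne_zero_iff.2 fun i _ => by positivity
    push_cast
    field_simp

lemma derivative_prod (f : ℕ → PowerSeries ℝ) (T : Finset ℕ) :
    PowerSeries.derivative ℝ (∏ p ∈ T, f p) =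
      ∑ p ∈ T, PowerSeries.derivative ℝ (f p) * ∏ q ∈ T.erase p, f q := by
  induction T using Finset.induction_on with
  | empty => simp
  | insert a T ha ih =>
    rw [prod_insert ha, Derivation.leibniz, ih, sum_insert ha, erase_insert ha, add_comm,
      smul_eq_mul, smul_eq_mul, mul_comm, mul_sum]
    congr 1
    refine sum_congr rfl fun p hp => ?_
    have hpa : a ≠ p := fun h => ha (h ▸ hp)
    rw [erase_insert_of_ne hpa, prod_insert (fun h => ha (mem_of_mem_erase h))]
    ring

lemma abs_coeff_prod_le {μ : ℕ → ℕ → ℝ} {v : ℕ → ℝ} {L V : ℝ} (P : Finset ℕ)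
    (h0 : ∀ p ∈ P, μ p 0 = 1) (hv : ∀ p ∈ P, ∀ j, 2 ≤ j → |μ p j| ≤ v p)
    (hL : ∑ p ∈ P, |μ p 1| ≤ L) (hV : ∑ p ∈ P, v p ≤ V) (k : ℕ) :
    ∀ T ⊆ P, |PowerSeries.coeff k (∏ p ∈ T, momentSeries (μ p))| ≤ majorant L V k := by
  have hL0 : 0 ≤ L := le_trans (sum_nonneg fun _ _ => abs_nonneg _) hL
  have hv0 : ∀ p ∈ P, 0 ≤ v p := fun p hp => (abs_nonneg _).trans (hv p hp 2 le_rfl)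
  have hV0 : 0 ≤ V := le_trans (sum_nonneg hv0) hV
  induction k using Nat.strong_induction_on with
  | _ k ih =>
    intro T hT
    cases k with
    | zero =>
      rw [majorant_zero, PowerSeries.coeff_zero_eq_constantCoeff_apply, map_prod]
      rw [prod_eq_one]
      · simp
      · intro p hp
        rw [← PowerSeries.coeff_zero_eq_constantCoeff_apply]
        simp [momentSeries, h0 p (hT hp)]
    | succ k =>
      have hd := congrArg (PowerSeries.coeff k) (derivative_prod (fun p => momentSeries (μ p)) T)
      rw [PowerSeries.coeff_derivative, map_sum] at hd
      have hterm : ∀ p ∈ T, |PowerSeries.coeff k (PowerSeries.derivative ℝ (momentSeries (μ p)) *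
          ∏ q ∈ T.erase p, momentSeries (μ q))| ≤ |μ p 1| * majorant L V k +
          v p * ∑ i ∈ range k, majorant L V (k - 1 - i) / ((i + 1).factorial : ℝ) := by
        intro p hp
        have hE : T.erase p ⊆ P := (erase_subset _ _).trans hT
        rw [PowerSeries.coeff_mul, Nat.sum_antidiagonal_eq_sum_range_succ_mk, sum_range_succ',
          mul_sum, add_comm]
        refine (abs_add_le _ _).trans (add_le_add ?_ ((abs_sum_le_sum_abs _ _).trans
          (sum_le_sum fun i hi => ?_)))
        · simp only [PowerSeries.coeff_derivative, momentSeries, PowerSeries.coeff_mk]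
          rw [abs_mul]
          have := ih k (by omega) _ hE
          simp only [momentSeries] at this
          simpa using mul_le_mul_of_nonneg_left this (abs_nonneg (μ p 1))
        · rw [PowerSeries.coeff_derivative, abs_mul]
          have hi' := mem_range.1 hi
          have h1 := ih (k - (i + 1)) (by omega) _ hE
          have h2 : |PowerSeries.coeff (i + 1 + 1) (momentSeries (μ p)) * (((i + 1 : ℕ) : ℝ) + 1)|
              ≤ v p / ((i + 1).factorial : ℝ) := by
            simp only [momentSeries, PowerSeries.coeff_mk]
            have : μ p (i + 1 + 1) / ((i + 1 + 1).factorial : ℝ) * (((i + 1 : ℕ) : ℝ) + 1)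
                = μ p (i + 1 + 1) / ((i + 1).factorial : ℝ) := by
              rw [Nat.factorial_succ (i + 1)]
              push_cast
              field_simp
            rw [this, abs_div, Nat.abs_cast]
            gcongr
            exact hv p (hT hp) _ (by omega)
          calc _ ≤ v p / ((i + 1).factorial : ℝ) * majorant L V (k - (i + 1)) :=
                mul_le_mul h2 h1 (abs_nonneg _) (div_nonneg (hv0 p (hT hp)) (by positivity))
            _ = _ := by rw [show k - 1 - i = k - (i + 1) by omega]; ring
      have hsum : |PowerSeries.coeff (k + 1) (∏ p ∈ T, momentSeries (μ p)) * ((k : ℝ) + 1)| ≤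
          ((k : ℝ) + 1) * majorant L V (k + 1) := by
        rw [hd, majorant_succ]
        refine (abs_sum_le_sum_abs _ _).trans ((sum_le_sum hterm).trans ?_)
        rw [sum_add_distrib, ← sum_mul, ← sum_mul]
        have hm := majorant_nonneg hL0 hV0
        have hs0 : 0 ≤ ∑ i ∈ range k, majorant L V (k - 1 - i) / ((i + 1).factorial : ℝ) :=
          sum_nonneg fun i _ => div_nonneg (hm _) (by positivity)
        refine add_le_add (mul_le_mul_of_nonneg_right ?_ (hm _))
          (mul_le_mul_of_nonneg_right ?_ hs0)
        · exact (sum_le_sum_of_subset_of_nonneg hT fun _ _ _ => abs_nonneg _).trans hL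
        · exact (sum_le_sum_of_subset_of_nonneg hT fun p hp _ => hv0 p hp).trans hV
      rw [abs_mul, abs_of_pos (by positivity : (0 : ℝ) < (k : ℝ) + 1), mul_comm] at hsum
      exact le_of_mul_le_mul_left hsum (by positivity)

lemma abs_sumMoment_le {μ : ℕ → ℕ → ℝ} {v : ℕ → ℝ} {L V : ℝ} (P : Finset ℕ)
    (h0 : ∀ p ∈ P, μ p 0 = 1) (hv : ∀ p ∈ P, ∀ j, 2 ≤ j → |μ p j| ≤ v p)
    (hL : ∑ p ∈ P, |μ p 1| ≤ L) (hV : ∑ p ∈ P, v p ≤ V) (k : ℕ) :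
    |sumMoment μ P k| ≤ (k.factorial : ℝ) * majorant L V k := by
  rw [sumMoment_eq, abs_mul, Nat.abs_cast]
  exact mul_le_mul_of_nonneg_left (abs_coeff_prod_le P h0 hv hL hV k P subset_rfl) (by positivity)

/-- `F` factors through reduction modulo `q`, is bounded by `1`, and has mean `A` modulo `q`. -/
def PeriodicMean (n q : ℕ) (F : (Fin n → ℤ) → ℝ) (A : ℝ) : Prop :=
  ∃ _ : NeZero q, ∃ G : (Fin n → ZMod q) → ℝ, (∀ a, F a = G fun i => (a i : ZMod q)) ∧
    (∑ b, G b = A * (q : ℝ) ^ n) ∧ ∀ b, |G b| ≤ 1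

lemma PeriodicMean.one (n : ℕ) : PeriodicMean n 1 (fun _ => 1) 1 :=
  ⟨inferInstance, fun _ => 1, fun _ => rfl, by simp, fun _ => by simp⟩

lemma PeriodicMean.mul {n q q' : ℕ} {F F' : (Fin n → ℤ) → ℝ} {A A' : ℝ}
    (h : PeriodicMean n q F A) (h' : PeriodicMean n q' F' A') (hq : Nat.Coprime q q') :
    PeriodicMean n (q * q') (fun a => F a * F' a) (A * A') := by
  obtain ⟨_, G, hG, hA, hb⟩ := h
  obtain ⟨_, G', hG', hA', hb'⟩ := h'
  let e := ZMod.chineseRemainder hq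
  refine ⟨⟨mul_ne_zero (NeZero.ne q) (NeZero.ne q')⟩,
    fun b => G (fun i => (e (b i)).1) * G' (fun i => (e (b i)).2), ?_, ?_, ?_⟩
  · intro a
    simp [hG, hG']
  · let E : (Fin n → ZMod (q * q')) ≃ (Fin n → ZMod q) × (Fin n → ZMod q') :=
      (Equiv.arrowCongr (Equiv.refl _) e.toEquiv).trans (Equiv.arrowProdEquivProdArrow _ _ _)
    have : NeZero (q * q') := ⟨mul_ne_zero (NeZero.ne q) (NeZero.ne q')⟩
    rw [Fintype.sum_equiv E (fun b => G (fun i => (e (b i)).1) * G' (fun i => (e (b i)).2))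
      (fun c => G c.1 * G' c.2) (fun b => rfl), Fintype.sum_prod_type]
    simp_rw [← mul_sum]
    rw [← sum_mul, hA, hA']
    push_cast
    ring
  · intro b
    rw [abs_mul]
    exact mul_le_one₀ (hb _) (abs_nonneg _) (hb' _)

lemma PeriodicMean.prod {n : ℕ} {F : ℕ → (Fin n → ℤ) → ℝ} {A : ℕ → ℝ} (D : Finset ℕ)
    (hD : ∀ p ∈ D, p.Prime) (h : ∀ p ∈ D, PeriodicMean n p (F p) (A p)) :
    PeriodicMean n (∏ p ∈ D, p) (fun a => ∏ p ∈ D, F p a) (∏ p ∈ D, A p) := by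
  induction D using Finset.induction_on with
  | empty => simpa using PeriodicMean.one n
  | insert p D hp ih =>
    simp only [prod_insert hp]
    refine (h p (mem_insert_self _ _)).mul (ih (fun q hq => hD q (mem_insert_of_mem hq))
      (fun q hq => h q (mem_insert_of_mem hq))) ?_
    refine Nat.Coprime.prod_right fun q hq => ?_
    refine (Nat.coprime_primes (hD p (mem_insert_self _ _)) (hD q (mem_insert_of_mem hq))).2 ?_
    rintro rfl
    exact hp hq

lemma abs_card_residue_sub_le (N q : ℕ) [NeZero q] (c : ZMod q) :
    |(((Finset.Icc (-(N : ℤ)) N).filter fun a : ℤ => (a : ZMod q) = c).card : ℝ) -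
      (2 * N + 1) / q| ≤ 1 := by
  obtain ⟨v, rfl⟩ := ZMod.intCast_surjective c
  have hq : (0 : ℤ) < q := by exact_mod_cast NeZero.pos q
  have h := Int.Ioc_filter_modEq_card (-(N : ℤ) - 1) N (r := q) hq v
  have hset : ((Finset.Icc (-(N : ℤ)) N).filter fun a : ℤ => (a : ZMod q) = v) =
      (Finset.Ioc (-(N : ℤ) - 1) N).filter fun x => x ≡ v [ZMOD q] := by
    ext x
    simp only [mem_filter, mem_Icc, mem_Ioc, ZMod.intCast_eq_intCast_iff]
    constructor <;> rintro ⟨⟨h1, h2⟩, h3⟩ <;> exact ⟨⟨by omega, by omega⟩, h3⟩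
  rw [hset]
  have hmono : ⌊((-(N : ℤ) - 1 : ℤ) - v : ℚ) / (q : ℤ)⌋ ≤ ⌊((N : ℤ) - v : ℚ) / (q : ℤ)⌋ := by
    refine Int.floor_le_floor ?_
    gcongr
    have : (0 : ℚ) ≤ N := by positivity
    linarith
  rw [max_eq_left (by linarith)] at h
  have h' : (((Finset.Ioc (-(N : ℤ) - 1) N).filter fun x => x ≡ v [ZMOD q]).card : ℚ) =
      ⌊((N : ℤ) - v : ℚ) / (q : ℤ)⌋ - ⌊((-(N : ℤ) - 1 : ℤ) - v : ℚ) / (q : ℤ)⌋ := by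
    exact_mod_cast h
  have key : |(((Finset.Ioc (-(N : ℤ) - 1) N).filter fun x => x ≡ v [ZMOD q]).card : ℚ) -
      (2 * N + 1) / q| ≤ 1 := by
    rw [h']
    have a1 := Int.floor_le (((N : ℤ) - v : ℚ) / (q : ℤ))
    have a2 := Int.lt_floor_add_one (((N : ℤ) - v : ℚ) / (q : ℤ))
    have b1 := Int.floor_le (((-(N : ℤ) - 1 : ℤ) - v : ℚ) / (q : ℤ))
    have b2 := Int.lt_floor_add_one (((-(N : ℤ) - 1 : ℤ) - v : ℚ) / (q : ℤ))
    have e : (2 * N + 1 : ℚ) / q = ((N : ℤ) - v : ℚ) / (q : ℤ) -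
        ((-(N : ℤ) - 1 : ℤ) - v : ℚ) / (q : ℤ) := by
      push_cast; ring
    rw [e, abs_le]
    constructor <;> linarith
  have key' := (Rat.cast_le (K := ℝ)).2 key
  push_cast at key'
  exact key'

lemma abs_prod_sub_pow_le {n : ℕ} (w : Fin n → ℝ) {t : ℝ} (ht : 0 ≤ t) (hw : ∀ i, |w i - t| ≤ 1) :
    |∏ i, w i - t ^ n| ≤ (t + 1) ^ n - t ^ n := by
  induction n with
  | zero => simp
  | succ n ih =>
    rw [Fin.prod_univ_succ, pow_succ, pow_succ]
    have h1 := ih (fun i => w i.succ) (fun i => hw i.succ)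
    have h0 := hw 0
    set Q := ∏ i : Fin n, w i.succ
    have hQ : |Q| ≤ (t + 1) ^ n := by
      calc |Q| = |(Q - t ^ n) + t ^ n| := by ring_nf
        _ ≤ |Q - t ^ n| + |t ^ n| := abs_add_le _ _
        _ ≤ (t + 1) ^ n := by rw [abs_of_nonneg (by positivity : 0 ≤ t ^ n)]; linarith
    calc |w 0 * Q - t ^ n * t| = |(w 0 - t) * Q + t * (Q - t ^ n)| := by ring_nf
      _ ≤ |(w 0 - t) * Q| + |t * (Q - t ^ n)| := abs_add_le _ _
      _ = |w 0 - t| * |Q| + t * |Q - t ^ n| := by rw [abs_mul, abs_mul, abs_of_nonneg ht]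
      _ ≤ 1 * (t + 1) ^ n + t * ((t + 1) ^ n - t ^ n) := by gcongr
      _ = _ := by ring

lemma add_pow_sub_pow_le {s M : ℝ} (hs : 0 ≤ s) (hM : s ≤ M) (n : ℕ) :
    (M + s) ^ n - M ^ n ≤ n * 2 ^ n * s * M ^ n / M := by
  rcases hs.eq_or_lt with rfl | hs0
  · simp
  have hM0 : 0 < M := by linarith
  induction n with
  | zero => simp
  | succ n ih =>
    have h2 : (M + s) ^ n ≤ 2 ^ n * M ^ n := by
      rw [← mul_pow]; gcongr; linarith
    calc (M + s) ^ (n + 1) - M ^ (n + 1)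
        = M * ((M + s) ^ n - M ^ n) + s * (M + s) ^ n := by ring
      _ ≤ M * (n * 2 ^ n * s * M ^ n / M) + s * (2 ^ n * M ^ n) := by gcongr
      _ = (n + 1) * 2 ^ n * s * M ^ (n + 1) / M := by rw [pow_succ]; field_simp
      _ ≤ ((n + 1 : ℕ) : ℝ) * 2 ^ (n + 1) * s * M ^ (n + 1) / M := by
        push_cast
        gcongr
        · norm_num
        · omega

lemma card_coeffBox (n N : ℕ) : ((coeffBox n N).card : ℝ) = (2 * (N : ℝ) + 1) ^ n := by
  have h : (Finset.Icc (-(N : ℤ)) N).card = 2 * N + 1 := by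
    rw [Int.card_Icc]; omega
  simp [coeffBox, h]

lemma PeriodicMean.abs_sum_box_sub_le {n q : ℕ} {F : (Fin n → ℤ) → ℝ} {A : ℝ}
    (h : PeriodicMean n q F A) {N : ℕ} (hqN : q ≤ 2 * N + 1) :
    |∑ a ∈ coeffBox n N, F a - A * (2 * (N : ℝ) + 1) ^ n| ≤
      n * 2 ^ n * q * (2 * (N : ℝ) + 1) ^ n / (2 * N + 1) := by
  obtain ⟨_, G, hG, hA, hb⟩ := h
  have hq0 : (0 : ℝ) < q := by exact_mod_cast NeZero.pos q
  set M : ℝ := 2 * (N : ℝ) + 1 with hM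
  have hM0 : 0 < M := by positivity
  let cnt : ZMod q → ℝ := fun c =>
    (((Finset.Icc (-(N : ℤ)) N).filter fun a : ℤ => (a : ZMod q) = c).card : ℝ)
  have hsum : ∑ a ∈ coeffBox n N, F a = ∑ b : Fin n → ZMod q, G b * ∏ i, cnt (b i) := by
    simp_rw [hG]
    rw [← sum_fiberwise (coeffBox n N) (fun a => fun i => (a i : ZMod q))]
    refine sum_congr rfl fun b _ => ?_
    have : ∑ a ∈ (coeffBox n N).filter (fun a : Fin n → ℤ => (fun i => (a i : ZMod q)) = b),
        G (fun i => (a i : ZMod q)) =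
        ∑ a ∈ (coeffBox n N).filter (fun a : Fin n → ℤ => (fun i => (a i : ZMod q)) = b), G b :=
      sum_congr rfl fun a ha => by rw [(mem_filter.1 ha).2]
    rw [this, sum_const, nsmul_eq_mul, mul_comm]
    congr 1
    have hset : (coeffBox n N).filter (fun a : Fin n → ℤ => (fun i => (a i : ZMod q)) = b) =
        Fintype.piFinset fun i =>
          (Finset.Icc (-(N : ℤ)) N).filter fun a : ℤ => (a : ZMod q) = b i := by
      ext a
      simp only [coeffBox, mem_filter, Fintype.mem_piFinset, funext_iff]
      exact ⟨fun h i => ⟨h.1 i, h.2 i⟩, fun h => ⟨fun i => (h i).1, fun i => (h i).2⟩⟩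
    rw [hset, Fintype.card_piFinset]
    push_cast
    rfl
  have hAM : A * M ^ n = ∑ b : Fin n → ZMod q, G b * (M / q) ^ n := by
    rw [← sum_mul, hA, div_pow]
    field_simp
  rw [hsum, hAM, ← sum_sub_distrib]
  calc |∑ b : Fin n → ZMod q, (G b * ∏ i, cnt (b i) - G b * (M / q) ^ n)|
      ≤ ∑ b : Fin n → ZMod q, |G b * ∏ i, cnt (b i) - G b * (M / q) ^ n| :=
        abs_sum_le_sum_abs _ _
    _ ≤ ∑ _b : Fin n → ZMod q, ((M / q + 1) ^ n - (M / q) ^ n) := by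
        refine sum_le_sum fun b _ => ?_
        rw [← mul_sub, abs_mul]
        have := abs_prod_sub_pow_le (fun i => cnt (b i)) (t := M / q) (by positivity)
          (fun i => abs_card_residue_sub_le N q (b i))
        calc _ ≤ 1 * ((M / q + 1) ^ n - (M / q) ^ n) :=
              mul_le_mul (hb b) this (abs_nonneg _) zero_le_one
          _ = _ := one_mul _
    _ = (M + q) ^ n - M ^ n := by
        rw [sum_const, card_univ, Fintype.card_fun, ZMod.card, Fintype.card_fin, nsmul_eq_mul]
        push_cast
        rw [mul_sub, ← mul_pow, ← mul_pow]
        congr 2 <;> field_simp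
    _ ≤ _ := add_pow_sub_pow_le hq0.le (by rw [hM]; exact_mod_cast hqN) n

/-- The monic polynomial with lower coefficients `b` over `ZMod p`. -/
def zmodPoly {n p : ℕ} (b : Fin n → ZMod p) : Polynomial (ZMod p) :=
  X ^ n + ∑ i : Fin n, C (b i) * X ^ (i : ℕ)

/-- The proportion of monic polynomials of degree `n` modulo `p` with splitting type `r`. -/
def typeDensity (n : ℕ) (r : Fin n → ℕ) (p : ℕ) : ℝ :=
  (Nat.card {b : Fin n → ZMod p // SplitTypeOf (zmodPoly b) r} : ℝ) / (p : ℝ) ^ n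

/-- The indicator of splitting type `r` at `p`, centered at `δ(r)`. -/
def typeDev (n : ℕ) (r : Fin n → ℕ) (a : Fin n → ℤ) (p : ℕ) : ℝ :=
  (if HasSplitType n r a p then 1 else 0) - splitDelta n r

/-- The `j`-th moment of `typeDev` for coefficients equidistributed modulo `p`. -/
def devMoment (n : ℕ) (r : Fin n → ℕ) (p j : ℕ) : ℝ :=
  typeDensity n r p * (1 - splitDelta n r) ^ j +
    (1 - typeDensity n r p) * (-splitDelta n r) ^ j

lemma hasSplitType_iff {n : ℕ} (r : Fin n → ℕ) (a : Fin n → ℤ) (p : ℕ) :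
    HasSplitType n r a p ↔ SplitTypeOf (zmodPoly fun i => (a i : ZMod p)) r := by
  rw [HasSplitType, intPoly, zmodPoly]
  simp [Polynomial.map_sum]

lemma splitDelta_pos (n : ℕ) (r : Fin n → ℕ) : 0 < splitDelta n r :=
  prod_pos fun i _ => by positivity

lemma splitDelta_le_one (n : ℕ) (r : Fin n → ℕ) : splitDelta n r ≤ 1 := by
  refine prod_le_one (fun i _ => by positivity) fun i _ => ?_
  rw [div_le_one (by positivity)]
  exact_mod_cast Nat.one_le_iff_ne_zero.2 (by positivity)

lemma abs_indicator_sub_splitDelta_le (n : ℕ) (r : Fin n → ℕ) (Q : Prop) :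
    |(if Q then (1 : ℝ) else 0) - splitDelta n r| ≤ 1 := by
  have h0 := splitDelta_pos n r
  have h1 := splitDelta_le_one n r
  split_ifs <;> rw [abs_le] <;> constructor <;> linarith

lemma typeDensity_nonneg (n : ℕ) (r : Fin n → ℕ) (p : ℕ) : 0 ≤ typeDensity n r p := by
  unfold typeDensity; positivity

lemma typeDensity_le_one (n : ℕ) (r : Fin n → ℕ) (p : ℕ) [NeZero p] : typeDensity n r p ≤ 1 := by
  refine div_le_one_of_le₀ ?_ (by positivity)
  have h := Nat.card_le_card_of_injective
    (Subtype.val : {b : Fin n → ZMod p // SplitTypeOf (zmodPoly b) r} → _)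
    Subtype.val_injective
  rw [Nat.card_fun, Nat.card_zmod, Nat.card_fin] at h
  exact_mod_cast h

lemma periodicMean_typeDev_pow (n : ℕ) (r : Fin n → ℕ) {p : ℕ} (hp : p.Prime) (j : ℕ) :
    PeriodicMean n p (fun a => typeDev n r a p ^ j) (devMoment n r p j) := by
  have : NeZero p := ⟨hp.ne_zero⟩
  refine ⟨this, fun b => ((if SplitTypeOf (zmodPoly b) r then 1 else 0) - splitDelta n r) ^ j,
    fun a => ?_, ?_, fun b => ?_⟩
  · simp only [typeDev, hasSplitType_iff]
  · have h1 : ∀ b : Fin n → ZMod p,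
        ((if SplitTypeOf (zmodPoly b) r then (1 : ℝ) else 0) - splitDelta n r) ^ j =
        (if SplitTypeOf (zmodPoly b) r then (1 : ℝ) else 0) *
          ((1 - splitDelta n r) ^ j - (-splitDelta n r) ^ j) + (-splitDelta n r) ^ j := by
      intro b; split_ifs <;> simp
    have hp0 : (p : ℝ) ^ n ≠ 0 := by have := hp.ne_zero; positivity
    have hd : ∑ b : Fin n → ZMod p, (if SplitTypeOf (zmodPoly b) r then (1 : ℝ) else 0) =
        typeDensity n r p * (p : ℝ) ^ n := by
      rw [typeDensity, div_mul_cancel₀ _ hp0, sum_boole, Nat.card_eq_fintype_card,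
        Fintype.card_subtype]
    simp_rw [h1]
    rw [sum_add_distrib, ← sum_mul, hd, sum_const, card_univ, Fintype.card_fun, ZMod.card,
      Fintype.card_fin, nsmul_eq_mul, devMoment]
    push_cast
    ring
  · rw [abs_pow]
    exact pow_le_one₀ (abs_nonneg _) (abs_indicator_sub_splitDelta_le _ _ _)

lemma devMoment_zero (n : ℕ) (r : Fin n → ℕ) (p : ℕ) : devMoment n r p 0 = 1 := by
  simp [devMoment]

lemma devMoment_one (n : ℕ) (r : Fin n → ℕ) (p : ℕ) :
    devMoment n r p 1 = typeDensity n r p - splitDelta n r := by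
  simp only [devMoment]; ring

lemma abs_devMoment_le (n : ℕ) (r : Fin n → ℕ) (p : ℕ) [NeZero p] {j : ℕ} (hj : 2 ≤ j) :
    |devMoment n r p j| ≤ devMoment n r p 2 := by
  have h0 := splitDelta_pos n r
  have h1 := splitDelta_le_one n r
  have d0 := typeDensity_nonneg n r p
  have d1 := typeDensity_le_one n r p
  simp only [devMoment]
  refine (abs_add_le _ _).trans ?_
  rw [abs_mul, abs_mul, abs_of_nonneg d0, abs_of_nonneg (sub_nonneg.2 d1), abs_pow, abs_pow,
    abs_neg, abs_of_pos h0, abs_of_nonneg (sub_nonneg.2 h1), neg_sq]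
  have e1 : (1 - splitDelta n r) ^ j ≤ (1 - splitDelta n r) ^ 2 :=
    pow_le_pow_of_le_one (by linarith) (by linarith) hj
  have e2 : splitDelta n r ^ j ≤ splitDelta n r ^ 2 := pow_le_pow_of_le_one h0.le h1 hj
  have := sub_nonneg.2 d1
  gcongr

lemma devMoment_two_le (n : ℕ) (r : Fin n → ℕ) (p : ℕ) :
    devMoment n r p 2 ≤ splitDelta n r - splitDelta n r ^ 2 +
      |typeDensity n r p - splitDelta n r| := by
  have h0 := splitDelta_pos n r
  have h1 := splitDelta_le_one n r
  have e : devMoment n r p 2 = splitDelta n r - splitDelta n r ^ 2 +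
      (typeDensity n r p - splitDelta n r) * (1 - 2 * splitDelta n r) := by
    simp only [devMoment]; ring
  rw [e]
  gcongr
  refine (le_abs_self _).trans ?_
  rw [abs_mul]
  refine mul_le_of_le_one_right (abs_nonneg _) ?_
  rw [abs_le]; constructor <;> linarith

lemma abs_sum_box_pow_sub_le (n : ℕ) (r : Fin n → ℕ) {P : Finset ℕ} (hP : ∀ p ∈ P, p.Prime)
    {y k N : ℕ} (hy : 1 ≤ y) (hPy : ∀ p ∈ P, p ≤ y) (hyN : y ^ k ≤ 2 * N + 1) :
    |∑ a ∈ coeffBox n N, (∑ p ∈ P, typeDev n r a p) ^ k -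
        sumMoment (devMoment n r) P k * (2 * (N : ℝ) + 1) ^ n| ≤
      (P.card : ℝ) ^ k * (n * 2 ^ n * (y : ℝ) ^ k * (2 * (N : ℝ) + 1) ^ n / (2 * N + 1)) := by
  have hM0 : (0 : ℝ) < 2 * (N : ℝ) + 1 := by positivity
  have hterm : ∀ κ ∈ piAntidiag P k,
      |∑ a ∈ coeffBox n N, ∏ p ∈ P, typeDev n r a p ^ κ p -
        (∏ p ∈ P, devMoment n r p (κ p)) * (2 * (N : ℝ) + 1) ^ n| ≤
      n * 2 ^ n * (y : ℝ) ^ k * (2 * (N : ℝ) + 1) ^ n / (2 * N + 1) := by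
    intro κ hκ
    rw [mem_piAntidiag] at hκ
    set D := P.filter fun p => κ p ≠ 0 with hD
    have hcard : D.card ≤ k := by
      calc D.card = ∑ p ∈ D, 1 := by simp
        _ ≤ ∑ p ∈ D, κ p := sum_le_sum fun p hp => Nat.one_le_iff_ne_zero.2 (mem_filter.1 hp).2
        _ ≤ ∑ p ∈ P, κ p := sum_le_sum_of_subset (filter_subset _ _)
        _ = k := hκ.1
    have hq : ∏ p ∈ D, p ≤ y ^ k :=
      (prod_le_pow_card _ _ _ fun p hp => hPy p (mem_filter.1 hp).1).trans
        (Nat.pow_le_pow_right hy hcard)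
    have hres : ∀ g : ℕ → ℕ → ℝ, (∀ p, g p 0 = 1) →
        ∏ p ∈ P, g p (κ p) = ∏ p ∈ D, g p (κ p) := by
      intro g hg
      refine (prod_subset (filter_subset _ _) fun p hp hpD => ?_).symm
      have : κ p = 0 := by
        by_contra hne
        exact hpD (mem_filter.2 ⟨hp, hne⟩)
      rw [this, hg]
    have hpm := PeriodicMean.prod (n := n) (F := fun p a => typeDev n r a p ^ κ p)
      (A := fun p => devMoment n r p (κ p)) D (fun p hp => hP p (mem_filter.1 hp).1)
      (fun p hp => periodicMean_typeDev_pow n r (hP p (mem_filter.1 hp).1) _)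
    rw [hres (fun p j => devMoment n r p j) (devMoment_zero n r)]
    simp_rw [fun a => hres (fun p j => typeDev n r a p ^ j) (fun p => pow_zero _)]
    refine (hpm.abs_sum_box_sub_le (hq.trans hyN)).trans ?_
    gcongr
    exact_mod_cast hq
  have hmult : (P.card : ℝ) ^ k = ∑ κ ∈ piAntidiag P k, (Nat.multinomial P κ : ℝ) := by
    have := Finset.sum_pow_eq_sum_piAntidiag P (fun _ => (1 : ℝ)) k
    simpa using this
  have hlhs : ∑ a ∈ coeffBox n N, (∑ p ∈ P, typeDev n r a p) ^ k =
      ∑ κ ∈ piAntidiag P k, (Nat.multinomial P κ : ℝ) *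
        ∑ a ∈ coeffBox n N, ∏ p ∈ P, typeDev n r a p ^ κ p := by
    simp_rw [Finset.sum_pow_eq_sum_piAntidiag, mul_sum]
    exact sum_comm
  rw [hlhs, sumMoment, sum_mul, ← sum_sub_distrib, hmult, sum_mul]
  refine (abs_sum_le_sum_abs _ _).trans (sum_le_sum fun κ hκ => ?_)
  rw [mul_assoc, ← mul_sub, abs_mul, Nat.abs_cast]
  exact mul_le_mul_of_nonneg_left (hterm κ hκ) (Nat.cast_nonneg _)

lemma countSplit_sub_eq_sum (n : ℕ) (r : Fin n → ℕ) (a : Fin n → ℤ) (x : ℝ) :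
    (countSplit n r a x : ℝ) - splitDelta n r * primePi x =
      ∑ p ∈ (Finset.range (⌊x⌋₊ + 1)).filter Nat.Prime, typeDev n r a p := by
  simp only [typeDev]
  rw [sum_sub_distrib, sum_const, sum_boole, nsmul_eq_mul, filter_filter, countSplit, primePi,
    mul_comm]

/-- The monic irreducible divisors of a nonzero polynomial over `ZMod p`. -/
def monicFactors {p : ℕ} [Fact p.Prime] (g : Polynomial (ZMod p)) : Finset (Polynomial (ZMod p)) :=
  (UniqueFactorizationMonoid.normalizedFactors g).toFinset

lemma mem_monicFactors {p : ℕ} [Fact p.Prime] {g h : Polynomial (ZMod p)} (hg : g ≠ 0) :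
    h ∈ monicFactors g ↔ h.Monic ∧ Irreducible h ∧ h ∣ g := by
  rw [monicFactors, Multiset.mem_toFinset, Polynomial.mem_normalizedFactors_iff hg]
  tauto

lemma prod_monicFactors {p : ℕ} [Fact p.Prime] {g : Polynomial (ZMod p)} (hg : g.Monic)
    (hs : Squarefree g) : ∏ h ∈ monicFactors g, h = g := by
  rw [UniqueFactorizationMonoid.squarefree_iff_nodup_normalizedFactors hg.ne_zero] at hs
  rw [monicFactors, Finset.prod, Multiset.toFinset_val, hs.dedup, Multiset.map_id',
    UniqueFactorizationMonoid.prod_normalizedFactors_eq hg.ne_zero]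
  exact (Polynomial.normalize_eq_self_iff_monic hg.ne_zero).2 hg

/-- The monic irreducible polynomials of degree `d` over `ZMod p`. -/
def irrPolys (p : ℕ) [Fact p.Prime] (d : ℕ) : Finset (Polynomial (ZMod p)) :=
  (monicFactors (X ^ p ^ d - X : Polynomial (ZMod p))).filter fun h => h.natDegree = d

lemma mem_monicFactors_X_pow_sub_X {p : ℕ} [hp : Fact p.Prime] {d : ℕ} (hd : d ≠ 0)
    {h : Polynomial (ZMod p)} :
    h ∈ monicFactors (X ^ p ^ d - X : Polynomial (ZMod p)) ↔
      h.Monic ∧ Irreducible h ∧ h.natDegree ∣ d := by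
  rw [mem_monicFactors (FiniteField.X_pow_card_pow_sub_X_ne_zero _ hd hp.out.one_lt)]
  refine and_congr_right fun _ => and_congr_right fun hi => ?_
  rw [hi.natDegree_dvd_iff_dvd_X_pow_card_pow_sub_X, Nat.card_zmod]

lemma mem_irrPolys {p : ℕ} [Fact p.Prime] {d : ℕ} (hd : d ≠ 0) {h : Polynomial (ZMod p)} :
    h ∈ irrPolys p d ↔ h.Monic ∧ Irreducible h ∧ h.natDegree = d := by
  rw [irrPolys, mem_filter, mem_monicFactors_X_pow_sub_X hd]
  constructor
  · rintro ⟨⟨h1, h2, -⟩, h3⟩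
    exact ⟨h1, h2, h3⟩
  · rintro ⟨h1, h2, h3⟩
    exact ⟨⟨h1, h2, h3.dvd⟩, h3⟩

lemma sum_natDegree_monicFactors {p : ℕ} [hp : Fact p.Prime] {d : ℕ} (hd : d ≠ 0) :
    ∑ h ∈ monicFactors (X ^ p ^ d - X : Polynomial (ZMod p)), h.natDegree = p ^ d := by
  have hm : (X ^ p ^ d - X : Polynomial (ZMod p)).Monic :=
    monic_X_pow_sub (by rw [degree_X]; exact_mod_cast Nat.one_lt_pow hd hp.out.one_lt)
  have hs : Squarefree (X ^ p ^ d - X : Polynomial (ZMod p)) :=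
    (galois_poly_separable p _ (dvd_pow_self p hd)).squarefree
  rw [← natDegree_prod_of_monic, prod_monicFactors hm hs,
    FiniteField.X_pow_card_pow_sub_X_natDegree_eq _ hd hp.out.one_lt]
  intro h hh
  exact ((mem_monicFactors hm.ne_zero).1 hh).1

lemma mul_card_irrPolys_le (p : ℕ) [Fact p.Prime] {d : ℕ} (hd : d ≠ 0) :
    d * (irrPolys p d).card ≤ p ^ d := by
  rw [← sum_natDegree_monicFactors hd, mul_comm, ← smul_eq_mul, ← sum_const]
  calc ∑ _h ∈ irrPolys p d, d = ∑ h ∈ irrPolys p d, h.natDegree :=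
        sum_congr rfl fun h hh => (mem_filter.1 hh).2.symm
    _ ≤ _ := sum_le_sum_of_subset (filter_subset _ _)

lemma pow_le_mul_card_irrPolys_add (p : ℕ) [hp : Fact p.Prime] {d : ℕ} (hd : d ≠ 0) :
    p ^ d ≤ d * (irrPolys p d).card + d * p ^ (d - 1) := by
  have hmaps : ∀ h ∈ monicFactors (X ^ p ^ d - X : Polynomial (ZMod p)),
      h.natDegree ∈ d.divisors := fun h hh =>
    Nat.mem_divisors.2 ⟨((mem_monicFactors_X_pow_sub_X hd).1 hh).2.2, hd⟩
  rw [← sum_natDegree_monicFactors hd, ← sum_fiberwise_of_maps_to hmaps,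
    ← Nat.cons_self_properDivisors hd, sum_cons]
  have hfib : ∀ e, ∑ h ∈ (monicFactors (X ^ p ^ d - X : Polynomial (ZMod p))).filter
      (fun h => h.natDegree = e), h.natDegree =
      e * ((monicFactors (X ^ p ^ d - X : Polynomial (ZMod p))).filter
        (fun h => h.natDegree = e)).card := by
    intro e
    rw [mul_comm, ← smul_eq_mul, ← sum_const]
    exact sum_congr rfl fun h hh => (mem_filter.1 hh).2
  refine add_le_add (hfib d).le ?_
  calc _ ≤ ∑ e ∈ d.properDivisors, p ^ (d - 1) := by
        refine sum_le_sum fun e he => ?_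
        have hed := Nat.mem_properDivisors.1 he
        have he0 : e ≠ 0 := (Nat.pos_of_mem_properDivisors he).ne'
        rw [hfib]
        calc _ ≤ e * (irrPolys p e).card := by
              gcongr
              intro h hh
              obtain ⟨h1, h2⟩ := mem_filter.1 hh
              have h3 := (mem_monicFactors_X_pow_sub_X hd).1 h1
              exact (mem_irrPolys he0).2 ⟨h3.1, h3.2.1, h2⟩
          _ ≤ p ^ e := mul_card_irrPolys_le p he0
          _ ≤ p ^ (d - 1) := Nat.pow_le_pow_right hp.out.pos (by omega)
    _ = d.properDivisors.card * p ^ (d - 1) := by rw [sum_const, smul_eq_mul]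
    _ ≤ d * p ^ (d - 1) := by
        gcongr
        calc _ ≤ (Finset.range d).card := card_le_card fun e he =>
              Finset.mem_range.2 (Nat.mem_properDivisors.1 he).2
          _ = d := card_range d

lemma abs_card_irrPolys_div_sub_le (p : ℕ) [hp : Fact p.Prime] {d : ℕ} (hd : d ≠ 0) :
    |((irrPolys p d).card : ℝ) / (p : ℝ) ^ d - 1 / d| ≤ 1 / p := by
  have hp0 : (0 : ℝ) < p := by exact_mod_cast hp.out.pos
  have hd0 : (0 : ℝ) < d := by exact_mod_cast Nat.pos_of_ne_zero hd
  have h1 : (d : ℝ) * (irrPolys p d).card ≤ (p : ℝ) ^ d := by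
    exact_mod_cast mul_card_irrPolys_le p hd
  have h2 : (p : ℝ) ^ d ≤ d * (irrPolys p d).card + d * (p : ℝ) ^ (d - 1) := by
    exact_mod_cast pow_le_mul_card_irrPolys_add p hd
  obtain ⟨e, rfl⟩ := Nat.exists_eq_succ_of_ne_zero hd
  simp only [Nat.succ_eq_add_one, Nat.add_sub_cancel] at *
  rw [abs_le]
  constructor
  · rw [neg_le_sub_iff_le_add, div_add_div _ _ (by positivity) (by positivity),
      div_le_div_iff₀ (by positivity) (by positivity)]
    have := mul_le_mul_of_nonneg_right h2 hp0.le
    calc 1 * ((p : ℝ) ^ (e + 1) * p) = (p : ℝ) ^ (e + 1) * p := by ring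
      _ ≤ _ := this
      _ = _ := by ring
  · refine le_trans ?_ (by positivity : (0 : ℝ) ≤ 1 / p)
    rw [sub_nonpos, div_le_div_iff₀ (by positivity) (by positivity)]
    linarith

lemma zmodPoly_tail_degree_lt {n p : ℕ} (b : Fin n → ZMod p) :
    (∑ i : Fin n, C (b i) * X ^ (i : ℕ) : Polynomial (ZMod p)).degree < n := by
  refine (degree_sum_le _ _).trans_lt ((Finset.sup_lt_iff (WithBot.bot_lt_coe n)).2 fun i _ => ?_)
  exact (degree_C_mul_X_pow_le _ _).trans_lt (Nat.cast_lt.2 i.2)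

lemma zmodPoly_monic {n p : ℕ} (b : Fin n → ZMod p) : (zmodPoly b).Monic :=
  monic_X_pow_add (zmodPoly_tail_degree_lt b)

lemma zmodPoly_natDegree {n p : ℕ} [hp : Fact p.Prime] (b : Fin n → ZMod p) :
    (zmodPoly b).natDegree = n := by
  refine natDegree_eq_of_degree_eq_some ?_
  rw [zmodPoly, degree_add_eq_left_of_degree_lt, degree_X_pow]
  rw [degree_X_pow]
  exact zmodPoly_tail_degree_lt b

lemma zmodPoly_coeff {n p : ℕ} (b : Fin n → ZMod p) (i : Fin n) :
    (zmodPoly b).coeff i = b i := by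
  simp [zmodPoly, coeff_X_pow, i.2.ne, Fin.val_inj]

lemma zmodPoly_injective {n p : ℕ} : Function.Injective (zmodPoly : (Fin n → ZMod p) → _) := by
  intro b c h
  ext i
  rw [← zmodPoly_coeff b, ← zmodPoly_coeff c, h]

lemma exists_zmodPoly_eq {n p : ℕ} {g : Polynomial (ZMod p)} (hg : g.Monic)
    (hn : g.natDegree = n) : ∃ b : Fin n → ZMod p, zmodPoly b = g := by
  refine ⟨fun i => g.coeff i, ?_⟩
  conv_rhs => rw [hg.as_sum, hn]
  rw [zmodPoly, Fin.sum_univ_eq_sum_range fun i => C (g.coeff i) * X ^ i]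

/-- The monic irreducible divisors of degree `i + 1`. -/
def factorsOfDegree {p : ℕ} [Fact p.Prime] (g : Polynomial (ZMod p)) (i : ℕ) :
    Finset (Polynomial (ZMod p)) :=
  (irrPolys p (i + 1)).filter fun h => h ∣ g

lemma mem_factorsOfDegree {p : ℕ} [Fact p.Prime] {g h : Polynomial (ZMod p)} {i : ℕ} :
    h ∈ factorsOfDegree g i ↔ h.Monic ∧ Irreducible h ∧ h.natDegree = i + 1 ∧ h ∣ g := by
  rw [factorsOfDegree, mem_filter, mem_irrPolys i.succ_ne_zero]
  tauto

lemma splitTypeOf_iff {p : ℕ} [Fact p.Prime] {g : Polynomial (ZMod p)} {n : ℕ} {r : Fin n → ℕ} :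
    SplitTypeOf g r ↔ Squarefree g ∧ ∀ i : Fin n, (factorsOfDegree g i).card = r i := by
  refine and_congr_right fun _ => forall_congr' fun i => ?_
  rw [← Nat.card_eq_finsetCard]
  simp only [mem_factorsOfDegree]

lemma biUnion_factorsOfDegree {p : ℕ} [Fact p.Prime] {g : Polynomial (ZMod p)} {n : ℕ}
    (hg : g ≠ 0) (hn : g.natDegree = n) :
    (univ : Finset (Fin n)).biUnion (fun i => factorsOfDegree g i) = monicFactors g := by
  ext h
  simp only [mem_biUnion, mem_univ, true_and, mem_factorsOfDegree, mem_monicFactors hg]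
  constructor
  · rintro ⟨i, h1, h2, h3, h4⟩
    exact ⟨h1, h2, h4⟩
  · rintro ⟨h1, h2, h3⟩
    have hpos := h2.natDegree_pos
    have hle := natDegree_le_of_dvd h3 hg
    exact ⟨⟨h.natDegree - 1, by omega⟩, h1, h2, by simp; omega, h3⟩

lemma squarefree_prod_irreducible {p : ℕ} [Fact p.Prime] {U : Finset (Polynomial (ZMod p))}
    (hU : ∀ h ∈ U, h.Monic ∧ Irreducible h) : Squarefree (∏ h ∈ U, h) := by
  refine Finset.squarefree_prod_of_pairwise_isCoprime (fun f hf g hg hfg => ?_)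
    fun f hf => (hU f hf).2.squarefree
  refine (hU f hf).2.isRelPrime_iff_not_dvd.2 fun hd => hfg ?_
  exact eq_of_monic_of_associated (hU f hf).1 (hU g hg).1
    ((hU f hf).2.associated_of_dvd (hU g hg).2 hd)

lemma irreducible_dvd_prod_iff {p : ℕ} [Fact p.Prime] {U : Finset (Polynomial (ZMod p))}
    (hU : ∀ h ∈ U, h.Monic ∧ Irreducible h) {f : Polynomial (ZMod p)} (hf : f.Monic)
    (hi : Irreducible f) : f ∣ ∏ h ∈ U, h ↔ f ∈ U := by
  refine ⟨fun hd => ?_, fun hm => dvd_prod_of_mem _ hm⟩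
  obtain ⟨g, hg, hfg⟩ := (hi.prime.dvd_finsetProd_iff _).1 hd
  rwa [eq_of_monic_of_associated hf (hU g hg).1 (hi.associated_of_dvd (hU g hg).2 hfg)]

lemma card_splitTypeOf {n : ℕ} {r : Fin n → ℕ} (hr : ∑ i : Fin n, ((i : ℕ) + 1) * r i = n)
    (p : ℕ) [Fact p.Prime] :
    Nat.card {b : Fin n → ZMod p // SplitTypeOf (zmodPoly b) r} =
      ∏ i : Fin n, (irrPolys p (i + 1)).card.choose (r i) := by
  rw [Nat.card_eq_fintype_card, Fintype.card_subtype]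
  have hcard : ∏ i : Fin n, (irrPolys p (i + 1)).card.choose (r i) =
      (Fintype.piFinset fun i : Fin n => (irrPolys p (i + 1)).powersetCard (r i)).card := by
    rw [Fintype.card_piFinset]
    simp [card_powersetCard]
  rw [hcard]
  refine card_bij (fun b _ i => factorsOfDegree (zmodPoly b) i) ?_ ?_ ?_
  · intro b hb
    have hb' := splitTypeOf_iff.1 (mem_filter.1 hb).2
    exact Fintype.mem_piFinset.2 fun i => mem_powersetCard.2 ⟨filter_subset _ _, hb'.2 i⟩
  · intro b hb c hc hbc
    refine zmodPoly_injective ?_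
    rw [← prod_monicFactors (zmodPoly_monic b) (mem_filter.1 hb).2.1,
      ← prod_monicFactors (zmodPoly_monic c) (mem_filter.1 hc).2.1,
      ← biUnion_factorsOfDegree (zmodPoly_monic b).ne_zero (zmodPoly_natDegree b),
      ← biUnion_factorsOfDegree (zmodPoly_monic c).ne_zero (zmodPoly_natDegree c)]
    exact congrArg (fun s : Fin n → Finset (Polynomial (ZMod p)) => ∏ h ∈ univ.biUnion s, h) hbc
  · intro s hs
    have hs' : ∀ i, s i ⊆ irrPolys p (i + 1) ∧ (s i).card = r i := fun i =>
      mem_powersetCard.1 (Fintype.mem_piFinset.1 hs i)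
    have hmem : ∀ i, ∀ h ∈ s i, h.Monic ∧ Irreducible h ∧ h.natDegree = (i : ℕ) + 1 :=
      fun i h hh => (mem_irrPolys (Nat.succ_ne_zero _)).1 ((hs' i).1 hh)
    set U := (univ : Finset (Fin n)).biUnion s with hUdef
    have hU : ∀ h ∈ U, h.Monic ∧ Irreducible h := by
      intro h hh
      obtain ⟨i, -, hi⟩ := mem_biUnion.1 hh
      exact ⟨(hmem i h hi).1, (hmem i h hi).2.1⟩
    have hmonic : (∏ h ∈ U, h).Monic := monic_prod_of_monic _ _ fun h hh => (hU h hh).1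
    have hdeg : (∏ h ∈ U, h).natDegree = n := by
      rw [natDegree_prod_of_monic _ _ fun h hh => (hU h hh).1, hUdef, sum_biUnion]
      · conv_rhs => rw [← hr]
        refine sum_congr rfl fun i _ => ?_
        rw [sum_congr rfl fun h hh => (hmem i h hh).2.2, sum_const, (hs' i).2, smul_eq_mul,
          mul_comm]
      · intro i _ j _ hij
        refine disjoint_left.2 fun h hi hj => hij (Fin.ext ?_)
        have h1 := (hmem i h hi).2.2
        have h2 := (hmem j h hj).2.2
        omega
    obtain ⟨b, hb⟩ := exists_zmodPoly_eq hmonic hdeg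
    have hfac : ∀ i : Fin n, factorsOfDegree (zmodPoly b) i = s i := by
      intro i
      ext h
      rw [mem_factorsOfDegree, hb]
      constructor
      · rintro ⟨h1, h2, h3, h4⟩
        obtain ⟨j, -, hj⟩ := mem_biUnion.1 ((irreducible_dvd_prod_iff hU h1 h2).1 h4)
        have : j = i := Fin.ext (by have := (hmem j h hj).2.2; omega)
        exact this ▸ hj
      · intro hh
        obtain ⟨h1, h2, h3⟩ := hmem i h hh
        exact ⟨h1, h2, h3, dvd_prod_of_mem _ (mem_biUnion.2 ⟨i, mem_univ _, hh⟩)⟩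
    refine ⟨b, mem_filter.2 ⟨mem_univ _, splitTypeOf_iff.2 ⟨?_, fun i => ?_⟩⟩, funext hfac⟩
    · rw [hb]; exact squarefree_prod_irreducible hU
    · rw [hfac]; exact (hs' i).2

/-- `f p = v + O(1/p)` over the primes. -/
def PrimeApprox (f : ℕ → ℝ) (v : ℝ) : Prop :=
  ∃ A : ℝ, 0 ≤ A ∧ ∀ p : ℕ, p.Prime → |f p - v| ≤ A / p

lemma PrimeApprox.const (v : ℝ) : PrimeApprox (fun _ => v) v :=
  ⟨0, le_rfl, fun p _ => by simp⟩

lemma PrimeApprox.mul {f g : ℕ → ℝ} {v w : ℝ} (hf : PrimeApprox f v) (hg : PrimeApprox g w) :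
    PrimeApprox (fun p => f p * g p) (v * w) := by
  obtain ⟨A, hA, hf⟩ := hf
  obtain ⟨B, hB, hg⟩ := hg
  refine ⟨(|v| + A) * B + |w| * A, by positivity, fun p hp => ?_⟩
  have h1 := hf p hp
  have h2 := hg p hp
  have hp1 : (1 : ℝ) ≤ p := by exact_mod_cast hp.one_le
  have hfv : |f p| ≤ |v| + A := by
    have : A / p ≤ A := div_le_self hA hp1
    have := abs_sub_abs_le_abs_sub (f p) v
    linarith
  calc |f p * g p - v * w| = |f p * (g p - w) + w * (f p - v)| := by ring_nf
    _ ≤ |f p| * |g p - w| + |w| * |f p - v| := by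
      rw [← abs_mul, ← abs_mul]; exact abs_add_le _ _
    _ ≤ (|v| + A) * (B / p) + |w| * (A / p) := by gcongr
    _ = _ := by ring

lemma PrimeApprox.prod {ι : Type*} (s : Finset ι) {f : ι → ℕ → ℝ} {v : ι → ℝ}
    (h : ∀ i ∈ s, PrimeApprox (f i) (v i)) :
    PrimeApprox (fun p => ∏ i ∈ s, f i p) (∏ i ∈ s, v i) := by
  induction s using Finset.induction_on with
  | empty => simpa using PrimeApprox.const 1
  | insert i s hi ih =>
    simp only [prod_insert hi]
    exact (h i (mem_insert_self _ _)).mul (ih fun j hj => h j (mem_insert_of_mem hj))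

/-- The number of monic irreducible polynomials of degree `d` modulo `p`, and `0` for `p` not prime. -/
def irrCount (p d : ℕ) : ℕ :=
  if hp : p.Prime then (@irrPolys p ⟨hp⟩ d).card else 0

lemma irrCount_eq (p : ℕ) [hp : Fact p.Prime] (d : ℕ) : irrCount p d = (irrPolys p d).card :=
  dif_pos hp.out

lemma primeApprox_irrCount_sub {d : ℕ} (hd : d ≠ 0) (j : ℕ) :
    PrimeApprox (fun p => ((irrCount p d - j : ℕ) : ℝ) / (p : ℝ) ^ d) (1 / d) := by
  refine ⟨1 + j, by positivity, fun p hp => ?_⟩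
  have : Fact p.Prime := ⟨hp⟩
  have hp1 : (1 : ℝ) ≤ p := by exact_mod_cast hp.one_le
  have h1 := abs_card_irrPolys_div_sub_le p hd
  simp only [irrCount_eq]
  set c := (irrPolys p d).card
  have h2 : |((c - j : ℕ) : ℝ) - c| ≤ j := by
    have e1 : c - j ≤ c := Nat.sub_le _ _
    have e2 : c ≤ (c - j) + j := by omega
    have e1' : ((c - j : ℕ) : ℝ) ≤ c := by exact_mod_cast e1
    have e2' : (c : ℝ) ≤ ((c - j : ℕ) : ℝ) + j := by exact_mod_cast e2
    rw [abs_le]; constructor <;> linarith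
  have h3 : |((c - j : ℕ) : ℝ) / (p : ℝ) ^ d - c / (p : ℝ) ^ d| ≤ j / p := by
    rw [← sub_div, abs_div, abs_of_nonneg (by positivity : (0 : ℝ) ≤ (p : ℝ) ^ d)]
    gcongr
    exact le_self_pow₀ hp1 hd
  calc _ ≤ _ := abs_sub_le _ ((c : ℝ) / (p : ℝ) ^ d) _
    _ ≤ j / p + 1 / p := add_le_add h3 h1
    _ = _ := by ring

lemma primeApprox_choose {d : ℕ} (hd : d ≠ 0) (m : ℕ) :
    PrimeApprox (fun p => ((irrCount p d).choose m : ℝ) / ((p : ℝ) ^ d) ^ m)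
      (1 / ((d ^ m * m.factorial : ℕ) : ℝ)) := by
  have h := (PrimeApprox.const (1 / (m.factorial : ℝ))).mul
    (PrimeApprox.prod (Finset.range m) fun j _ => primeApprox_irrCount_sub hd j)
  convert h using 1
  · funext p
    rw [prod_div_distrib, prod_const, card_range, ← Nat.cast_prod,
      ← Nat.descFactorial_eq_prod_range, Nat.descFactorial_eq_factorial_mul_choose]
    push_cast
    have : (m.factorial : ℝ) ≠ 0 := by positivity
    field_simp
  · rw [prod_const, card_range, one_div_pow]
    push_cast
    have : (m.factorial : ℝ) ≠ 0 := by positivity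
    field_simp

lemma primeApprox_typeDensity {n : ℕ} {r : Fin n → ℕ}
    (hr : ∑ i : Fin n, ((i : ℕ) + 1) * r i = n) :
    PrimeApprox (typeDensity n r) (splitDelta n r) := by
  obtain ⟨A, hA, h⟩ := PrimeApprox.prod (univ : Finset (Fin n)) fun i _ =>
    primeApprox_choose (Nat.succ_ne_zero (i : ℕ)) (r i)
  refine ⟨A, hA, fun p hp => ?_⟩
  have : Fact p.Prime := ⟨hp⟩
  have hd : typeDensity n r p = ∏ i : Fin n,
      ((irrCount p ((i : ℕ) + 1)).choose (r i) : ℝ) / ((p : ℝ) ^ ((i : ℕ) + 1)) ^ r i := by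
    rw [typeDensity, card_splitTypeOf hr, prod_div_distrib]
    push_cast
    simp_rw [irrCount_eq, ← pow_mul]
    rw [prod_pow_eq_pow_sum, hr]
  rw [hd]
  exact h p hp

lemma mem_range_algebraMap_of_pow_eq {p : ℕ} [hp : Fact p.Prime] {k : Type*} [Field k] [Finite k]
    [Algebra (ZMod p) k] {y : k} (hy : y ^ p = y) : ∃ c : ZMod p, algebraMap (ZMod p) k c = y := by
  have : IsGalois (ZMod p) k := inferInstance
  refine (IsGalois.mem_range_algebraMap_iff_fixed (F := ZMod p) y).2 fun φ => ?_
  obtain ⟨j, rfl⟩ := (FiniteField.bijective_frobeniusAlgEquivOfAlgebraic_pow (ZMod p) k).2 φ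
  simp only [AlgEquiv.coe_pow, FiniteField.coe_frobeniusAlgEquivOfAlgebraic, ZMod.card]
  exact Function.IsFixedPt.iterate hy _

lemma exists_pow_eq_of_root_irreducible {p : ℕ} [hp : Fact p.Prime] {k : Type*} [Field k]
    [Finite k] [Algebra (ZMod p) k] {h : Polynomial (ZMod p)} (hh : Irreducible h) {y z : k}
    (hy : aeval y h = 0) (hz : aeval z h = 0) : ∃ j : ℕ, (fun t : k => t ^ p)^[j] y = z := by
  have hconj : IsConjRoot (ZMod p) z y := by
    rw [isConjRoot_def, ← minpoly.eq_of_irreducible hh hy, ← minpoly.eq_of_irreducible hh hz]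
  obtain ⟨φ, hφ⟩ := isConjRoot_iff_exists_algEquiv.1 hconj
  obtain ⟨j, rfl⟩ := (FiniteField.bijective_frobeniusAlgEquivOfAlgebraic_pow (ZMod p) k).2 φ
  refine ⟨j, ?_⟩
  simpa only [AlgEquiv.coe_pow, FiniteField.coe_frobeniusAlgEquivOfAlgebraic, ZMod.card] using hφ

open NumberField in
/-- A Frobenius element at an unramified prime acts on the roots of `f` as the `p`-th power map
acts on the roots of the reduction of `f`. -/
lemma exists_frobenius {K : Type} [Field K] [NumberField K] [IsGalois ℚ K] {f : Polynomial ℤ}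
    (hf : f.Monic) (hs : (f.map (algebraMap ℤ K)).Splits) (p : ℕ) [hp : Fact p.Prime]
    (hsq : Squarefree (f.map (Int.castRingHom (ZMod p)))) :
    ∃ (k : Type) (_ : Field k) (_ : Finite k) (_ : Algebra (ZMod p) k) (σ : Gal(K/ℚ))
      (red : K → k),
      Set.BijOn red (f.rootSet K) ((f.map (Int.castRingHom (ZMod p))).rootSet k) ∧
      ∀ x ∈ f.rootSet K, red (σ x) = red x ^ p := by
  have hpz : (Ideal.span {(p : ℤ)}).IsMaximal :=
    Int.ideal_span_isMaximal_of_prime p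
  obtain ⟨Q, hQ, hQp⟩ := Ideal.exists_maximal_ideal_liesOver_of_isIntegral (S := 𝓞 K)
    (Ideal.span {(p : ℤ)})
  have hpQ : (p : 𝓞 K) ∈ Q := by
    have : (p : ℤ) ∈ Q.under ℤ := by
      rw [← hQp.over]; exact Ideal.mem_span_singleton_self _
    simpa using this
  have hQ0 : Q ≠ ⊥ := by
    rintro rfl
    exact hp.out.ne_zero (by exact_mod_cast (Ideal.mem_bot.1 hpQ))
  have hfin : Finite (𝓞 K ⧸ Q) := Ideal.finiteQuotientOfFreeOfNeBot Q hQ0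
  obtain ⟨σ, hσ⟩ := IsArithFrobAt.exists_of_isInvariant ℤ Gal(K/ℚ) Q
  let fk : Field (𝓞 K ⧸ Q) := Ideal.Quotient.field Q
  have hchar : CharP (𝓞 K ⧸ Q) p := by
    refine (CharP.charP_iff_prime_eq_zero hp.out).2 ?_
    rw [← map_natCast (Ideal.Quotient.mk Q)]
    exact Ideal.Quotient.eq_zero_iff_mem.2 hpQ
  let ak : Algebra (ZMod p) (𝓞 K ⧸ Q) := ZMod.algebra _ p
  have hcard : Nat.card (ℤ ⧸ Q.under ℤ) = p := by
    rw [← hQp.over, ← Submodule.cardQuot_apply, ← Ideal.absNorm_apply, Ideal.absNorm_span_singleton]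
    simp
  let lft : K → 𝓞 K := fun x => if h : IsIntegral ℤ x then ⟨x, h⟩ else 0
  have hlft : ∀ x ∈ f.rootSet K, algebraMap (𝓞 K) K (lft x) = x := by
    intro x hx
    have hx' : IsIntegral ℤ x := ⟨f, hf, (mem_rootSet.1 hx).2⟩
    have h1 : lft x = ⟨x, hx'⟩ := dif_pos hx'
    rw [h1]
    rfl
  have hfK : f.map (algebraMap ℤ (𝓞 K)) =
      (((f.aroots K).map lft).map fun t => X - C t).prod := by
    refine Polynomial.map_injective (algebraMap (𝓞 K) K) RingOfIntegers.coe_injective ?_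
    rw [Polynomial.map_map, ← IsScalarTower.algebraMap_eq, hs.eq_prod_roots,
      (hf.map _).leadingCoeff, C_1, one_mul, Polynomial.map_multiset_prod, Multiset.map_map,
      Multiset.map_map]
    congr 1
    refine Multiset.map_congr rfl fun x hx => ?_
    simp only [Function.comp_apply, Polynomial.map_sub, map_X, map_C]
    rw [hlft x (by rwa [rootSet, mem_coe, Multiset.mem_toFinset])]
  set g := f.map (Int.castRingHom (ZMod p)) with hg
  have hgk : g.map (algebraMap (ZMod p) (𝓞 K ⧸ Q)) =
      (((f.aroots K).map fun x => Ideal.Quotient.mk Q (lft x)).map fun t => X - C t).prod := by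
    have h1 : g.map (algebraMap (ZMod p) (𝓞 K ⧸ Q)) =
        (f.map (algebraMap ℤ (𝓞 K))).map (Ideal.Quotient.mk Q) := by
      rw [hg, Polynomial.map_map, Polynomial.map_map]
      congr 1
      exact RingHom.ext_int _ _
    rw [h1, hfK, Polynomial.map_multiset_prod, Multiset.map_map, Multiset.map_map,
      Multiset.map_map]
    congr 1
    refine Multiset.map_congr rfl fun x hx => ?_
    simp
  have hroots : g.aroots (𝓞 K ⧸ Q) = (f.aroots K).map fun x => Ideal.Quotient.mk Q (lft x) := by
    rw [aroots, hgk, roots_multiset_prod_X_sub_C]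
  have hnodup : ((f.aroots K).map fun x => Ideal.Quotient.mk Q (lft x)).Nodup := by
    rw [← hroots]
    exact nodup_roots (Separable.map (PerfectField.separable_iff_squarefree.2 hsq))
  have hmemK : ∀ x, x ∈ f.rootSet K ↔ x ∈ f.aroots K := fun x => by
    rw [rootSet, mem_coe, Multiset.mem_toFinset]
  have hmemk : ∀ x, x ∈ g.rootSet (𝓞 K ⧸ Q) ↔ x ∈ g.aroots (𝓞 K ⧸ Q) := fun x => by
    rw [rootSet, mem_coe, Multiset.mem_toFinset]
  refine ⟨𝓞 K ⧸ Q, fk, hfin, ak, σ, fun x => Ideal.Quotient.mk Q (lft x), ⟨?_, ?_, ?_⟩, ?_⟩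
  · intro x hx
    rw [hmemk, hroots]
    exact Multiset.mem_map_of_mem _ ((hmemK x).1 hx)
  · intro x hx y hy hxy
    exact Multiset.inj_on_of_nodup_map hnodup x ((hmemK x).1 hx) y ((hmemK y).1 hy) hxy
  · intro y hy
    rw [hmemk, hroots] at hy
    obtain ⟨x, hx, hxy⟩ := Multiset.mem_map.1 hy
    exact ⟨x, (hmemK x).2 hx, hxy⟩
  · intro x hx
    have hσx : σ x ∈ f.rootSet K := by
      rw [mem_rootSet] at hx ⊢
      refine ⟨hx.1, ?_⟩
      exact (aeval_algHom_apply ((σ : K →ₐ[ℚ] K).restrictScalars ℤ) x f).trans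
        (by rw [hx.2, map_zero])
    have h1 := hσ (lft x)
    rw [hcard] at h1
    have h2 : lft (σ x) = σ • lft x := by
      refine RingOfIntegers.coe_injective ?_
      rw [hlft _ hσx]
      change σ x = σ (algebraMap (𝓞 K) K (lft x))
      rw [hlft _ hx]
    simp only [h2, ← map_pow]
    exact Ideal.Quotient.eq.2 h1

lemma subgroup_eq_top_of_isSwap_mem {X : Type*} [Finite X] (H : Subgroup (Equiv.Perm X))
    (htrans : ∀ x y, ∃ g ∈ H, g x = y) {x₀ : X} {σ : Equiv.Perm X} (hσ : σ ∈ H)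
    (hcyc : ∀ y z, y ≠ x₀ → z ≠ x₀ → ∃ j : ℕ, (σ ^ j) y = z) (h₀ : σ x₀ = x₀)
    {τ : Equiv.Perm X} (hτ : τ ∈ H) (hsw : τ.IsSwap) : H = ⊤ := by
  have hconj : ∀ g ∈ H, ∀ u v, Equiv.swap u v ∈ H → Equiv.swap (g u) (g v) ∈ H := by
    intro g hg u v huv
    rw [Equiv.swap_apply_apply]
    exact H.mul_mem (H.mul_mem hg huv) (H.inv_mem hg)
  obtain ⟨u, v, huv, rfl⟩ := hsw
  obtain ⟨g, hg, hgu⟩ := htrans u x₀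
  have h1 := hconj g hg u v hτ
  rw [hgu] at h1
  have hw : g v ≠ x₀ := fun h => huv (g.injective (by rw [hgu, h]))
  have h2 : ∀ z, Equiv.swap x₀ z ∈ H := by
    intro z
    by_cases hz : z = x₀
    · rw [hz, Equiv.swap_self]; exact H.one_mem
    obtain ⟨j, hj⟩ := hcyc (g v) z hw hz
    have h3 := hconj (σ ^ j) (H.pow_mem hσ j) _ _ h1
    rwa [hj, Equiv.Perm.pow_apply_eq_self_of_apply_eq_self h₀] at h3
  rw [eq_top_iff, ← Equiv.Perm.closure_isSwap, Subgroup.closure_le]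
  rintro _ ⟨y, z, hyz, rfl⟩
  by_cases hz : z = x₀
  · rw [hz, Equiv.swap_comm]; exact h2 y
  by_cases hy : y = x₀
  · rw [hy]; exact h2 z
  have h4 := hconj _ (h2 y) _ _ (h2 z)
  rwa [Equiv.swap_apply_left, Equiv.swap_apply_of_ne_of_ne hz (Ne.symm hyz)] at h4

/-- `σ` acts on the roots of the reduction `g` as the `p`-th power map. -/
structure FrobeniusModel {p : ℕ} [Fact p.Prime] (g : Polynomial (ZMod p)) {X : Type*}
    (σ : Equiv.Perm X) (k : Type*) [Field k] [Algebra (ZMod p) k] (red : X → k) : Prop where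
  inj : Function.Injective red
  range : Set.range red = g.rootSet k
  map_perm : ∀ x, red (σ x) = red x ^ p

lemma FrobeniusModel.map_perm_pow {p : ℕ} [Fact p.Prime] {g : Polynomial (ZMod p)} {X : Type*}
    {σ : Equiv.Perm X} {k : Type*} [Field k] [Algebra (ZMod p) k] {red : X → k}
    (h : FrobeniusModel g σ k red) (j : ℕ) (x : X) :
    red ((σ ^ j) x) = (fun t : k => t ^ p)^[j] (red x) := by
  induction j with
  | zero => rfl
  | succ j ih =>
    rw [pow_succ', Equiv.Perm.mul_apply, h.map_perm, ih, Function.iterate_succ_apply']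

lemma card_factorsOfDegree_zero {p : ℕ} [Fact p.Prime] {g : Polynomial (ZMod p)} (hg : g ≠ 0) :
    (factorsOfDegree g 0).card = g.roots.toFinset.card := by
  refine (card_bij (fun c _ => X - C c) ?_ ?_ ?_).symm
  · intro c hc
    rw [Multiset.mem_toFinset, mem_roots hg] at hc
    exact mem_factorsOfDegree.2 ⟨monic_X_sub_C c, irreducible_X_sub_C c, natDegree_X_sub_C c,
      dvd_iff_isRoot.2 hc⟩
  · intro c _ d _ hcd
    simpa using hcd
  · intro h hh
    obtain ⟨h1, h2, h3, h4⟩ := mem_factorsOfDegree.1 hh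
    have he : h = X - C (-h.coeff 0) := by
      conv_lhs => rw [h1.as_sum, h3]
      simp
    refine ⟨-h.coeff 0, ?_, he.symm⟩
    rw [Multiset.mem_toFinset, mem_roots hg, ← dvd_iff_isRoot, ← he]
    exact h4

lemma FrobeniusModel.card_fixed {p : ℕ} [hp : Fact p.Prime] {g : Polynomial (ZMod p)} {X : Type*}
    [Fintype X] {σ : Equiv.Perm X} {k : Type*} [Field k] [Finite k] [Algebra (ZMod p) k]
    {red : X → k} (h : FrobeniusModel g σ k red) (hg : g ≠ 0) :
    (univ.filter fun x => σ x = x).card = (factorsOfDegree g 0).card := by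
  have hinj : Function.Injective (algebraMap (ZMod p) k) := (algebraMap (ZMod p) k).injective
  rw [card_factorsOfDegree_zero hg, ← card_image_of_injective _ h.inj,
    ← card_image_of_injective _ hinj]
  congr 1
  ext y
  simp only [mem_image, mem_filter, mem_univ, true_and, Multiset.mem_toFinset, mem_roots hg]
  constructor
  · rintro ⟨x, hx, rfl⟩
    have hpow : red x ^ p = red x := by rw [← h.map_perm, hx]
    obtain ⟨c, hc⟩ := mem_range_algebraMap_of_pow_eq hpow
    refine ⟨c, ?_, hc⟩
    have hr : red x ∈ g.rootSet k := h.range ▸ Set.mem_range_self x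
    have := (mem_rootSet.1 hr).2
    rw [← hc, aeval_algebraMap_apply] at this
    exact hinj (by rw [map_zero]; simpa using this)
  · rintro ⟨c, hc, rfl⟩
    have hr : algebraMap (ZMod p) k c ∈ g.rootSet k := by
      refine mem_rootSet.2 ⟨hg, ?_⟩
      rw [aeval_algebraMap_apply, coe_aeval_eq_eval, hc.eq_zero, map_zero]
    rw [← h.range] at hr
    obtain ⟨x, hx⟩ := hr
    refine ⟨x, h.inj ?_, hx⟩
    rw [h.map_perm, hx, ← map_pow, ZMod.pow_card]

lemma FrobeniusModel.isSwap {p : ℕ} [hp : Fact p.Prime] {g : Polynomial (ZMod p)} {X : Type*}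
    [Fintype X] {σ : Equiv.Perm X} {k : Type*} [Field k] [Finite k] [Algebra (ZMod p) k]
    {red : X → k} (h : FrobeniusModel g σ k red) (hg : g ≠ 0)
    (hc : (factorsOfDegree g 0).card + 2 = Fintype.card X) : σ.IsSwap := by
  rw [← Equiv.Perm.card_support_eq_two]
  have h1 := h.card_fixed hg
  have h2 := card_filter_add_card_filter_not (s := (univ : Finset X)) (fun x => σ x = x)
  have h3 : σ.support = univ.filter fun x => ¬ σ x = x := by
    ext x; simp
  rw [card_univ] at h2
  rw [h3]
  omega

lemma FrobeniusModel.exists_fixed {p : ℕ} [hp : Fact p.Prime] {g : Polynomial (ZMod p)}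
    {X : Type*} {σ : Equiv.Perm X} {k : Type*} [Field k] [Finite k] [Algebra (ZMod p) k]
    {red : X → k} (h : FrobeniusModel g σ k red) (hg : g.Monic) {n : ℕ} (hn : g.natDegree = n + 1)
    {q : Polynomial (ZMod p)} (hq : q ∈ factorsOfDegree g (n - 1)) (hn1 : 1 ≤ n) :
    ∃ x₀, σ x₀ = x₀ ∧ ∀ y z, y ≠ x₀ → z ≠ x₀ → ∃ j : ℕ, (σ ^ j) y = z := by
  obtain ⟨h1, h2, h3, u, hu⟩ := mem_factorsOfDegree.1 hq
  have hum : u.Monic := Monic.of_mul_monic_left h1 (hu ▸ hg)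
  have hud : u.natDegree = 1 := by
    have := h1.natDegree_mul hum
    rw [← hu] at this
    omega
  have hux : u = Polynomial.X - C (-u.coeff 0) := by
    conv_lhs => rw [hum.as_sum, hud]
    simp
  set c := -u.coeff 0
  have hr : algebraMap (ZMod p) k c ∈ g.rootSet k := by
    refine mem_rootSet.2 ⟨hg.ne_zero, ?_⟩
    rw [hu, hux]; simp
  rw [← h.range] at hr
  obtain ⟨x₀, hx₀⟩ := hr
  have hroot : ∀ y, y ≠ x₀ → aeval (red y) q = 0 := by
    intro y hy
    have hy' : red y ∈ g.rootSet k := h.range ▸ Set.mem_range_self y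
    have hy2 := (mem_rootSet.1 hy').2
    rw [hu, map_mul] at hy2
    refine (mul_eq_zero.1 hy2).resolve_right fun h0 => hy (h.inj ?_)
    rw [hux] at h0
    rw [hx₀]
    simpa [sub_eq_zero] using h0
  refine ⟨x₀, h.inj ?_, fun y z hy hz => ?_⟩
  · rw [h.map_perm, hx₀, ← map_pow, ZMod.pow_card]
  · obtain ⟨j, hj⟩ := exists_pow_eq_of_root_irreducible h2 (hroot y hy) (hroot z hz)
    exact ⟨j, h.inj (by rw [h.map_perm_pow, hj])⟩

lemma intPoly_tail_degree_lt {n : ℕ} (a : Fin n → ℤ) :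
    (∑ i : Fin n, C (a i) * X ^ (i : ℕ) : Polynomial ℤ).degree < n := by
  refine (degree_sum_le _ _).trans_lt ((Finset.sup_lt_iff (WithBot.bot_lt_coe n)).2 fun i _ => ?_)
  exact (degree_C_mul_X_pow_le _ _).trans_lt (Nat.cast_lt.2 i.2)

lemma intPoly_monic {n : ℕ} (a : Fin n → ℤ) : (intPoly n a).Monic :=
  monic_X_pow_add (intPoly_tail_degree_lt a)

lemma intPoly_natDegree {n : ℕ} (a : Fin n → ℤ) : (intPoly n a).natDegree = n := by
  refine natDegree_eq_of_degree_eq_some ?_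
  rw [intPoly, degree_add_eq_left_of_degree_lt, degree_X_pow]
  rw [degree_X_pow]
  exact intPoly_tail_degree_lt a

/-- The splitting type of an irreducible polynomial. -/
def irredType (n : ℕ) (i : Fin n) : ℕ := if (i : ℕ) + 1 = n then 1 else 0

/-- The splitting type of the product of a linear factor and an irreducible factor. -/
def linearIrredType (n : ℕ) (i : Fin n) : ℕ :=
  (if (i : ℕ) = 0 then 1 else 0) + if (i : ℕ) + 2 = n then 1 else 0

/-- The splitting type with one quadratic factor and all other factors linear. -/
def quadraticType (n : ℕ) (i : Fin n) : ℕ :=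
  (if (i : ℕ) = 0 then n - 2 else 0) + if (i : ℕ) = 1 then 1 else 0

lemma irreducible_of_irredType {n p : ℕ} (hn : 2 ≤ n) [hp : Fact p.Prime] {a : Fin n → ℤ}
    (h : HasSplitType n (irredType n) a p) : Irreducible (ratPoly n a) := by
  have hm := intPoly_monic a
  rw [HasSplitType, splitTypeOf_iff] at h
  have h1 := h.2 ⟨n - 1, by omega⟩
  simp only [irredType] at h1
  rw [if_pos (by omega), card_eq_one] at h1
  obtain ⟨q, hq⟩ := h1
  obtain ⟨q1, q2, q3, q4⟩ := mem_factorsOfDegree.1 (hq ▸ mem_singleton_self q)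
  have hd : ((intPoly n a).map (Int.castRingHom (ZMod p))).natDegree ≤ q.natDegree := by
    rw [hm.natDegree_map, intPoly_natDegree]; omega
  have he := eq_of_monic_of_dvd_of_natDegree_le q1 (hm.map _) q4 hd
  have hi : Irreducible (intPoly n a) :=
    hm.irreducible_of_irreducible_map (Int.castRingHom (ZMod p)) _ (he ▸ q2)
  exact (hm.irreducible_iff_irreducible_map_fraction_map (K := ℚ)).1 hi

lemma exists_frobeniusModel {n p : ℕ} [hp : Fact p.Prime] {a : Fin n → ℤ} {K : Type} [Field K]
    [NumberField K] [IsGalois ℚ K] [hspl : Fact ((ratPoly n a).map (algebraMap ℚ K)).Splits]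
    (hsq : Squarefree ((intPoly n a).map (Int.castRingHom (ZMod p)))) :
    ∃ σ ∈ (Gal.galActionHom (ratPoly n a) K).range,
      ∃ (k : Type) (_ : Field k) (_ : Finite k) (_ : Algebra (ZMod p) k)
        (red : (ratPoly n a).rootSet K → k),
        FrobeniusModel ((intPoly n a).map (Int.castRingHom (ZMod p))) σ k red := by
  have hmap : (ratPoly n a).map (algebraMap ℚ K) = (intPoly n a).map (algebraMap ℤ K) := by
    rw [ratPoly, Polynomial.map_map]
    congr 1
    exact RingHom.ext_int _ _
  have hset : (ratPoly n a).rootSet K = (intPoly n a).rootSet K := by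
    rw [rootSet, rootSet, aroots, aroots, hmap]
  obtain ⟨k, i1, i2, i3, σ, red, hbij, hσ⟩ := exists_frobenius (K := K)
    (intPoly_monic a) (hmap ▸ hspl.out) p hsq
  refine ⟨_, ⟨Gal.restrict (ratPoly n a) K σ, rfl⟩, k, i1, i2, i3, fun x => red x, ?_, ?_, ?_⟩
  · intro x y hxy
    exact Subtype.ext (hbij.injOn (hset ▸ x.2) (hset ▸ y.2) hxy)
  · rw [← hbij.image_eq, ← hset]
    ext y
    simp
  · intro x
    rw [Gal.galActionHom_restrict]
    exact hσ x (hset ▸ x.2)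

lemma nonempty_gal_mulEquiv_perm {n : ℕ} (hn : 2 ≤ n) {a : Fin n → ℤ} {K : Type} [Field K]
    [NumberField K] [IsGalois ℚ K] [hspl : Fact ((ratPoly n a).map (algebraMap ℚ K)).Splits]
    {q l : ℕ} [Fact q.Prime] [Fact l.Prime] (hirr : Irreducible (ratPoly n a))
    (h₂ : HasSplitType n (linearIrredType n) a q) (h₃ : HasSplitType n (quadraticType n) a l) :
    Nonempty ((ratPoly n a).Gal ≃* Equiv.Perm (Fin n)) := by
  have hm := intPoly_monic a
  have hcard : Fintype.card ((ratPoly n a).rootSet K) = n := by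
    rw [card_rootSet_eq_natDegree hirr.separable hspl.out, ratPoly,
      hm.natDegree_map, intPoly_natDegree]
  obtain ⟨σ, hσ, k, _, _, _, red, hred⟩ := exists_frobeniusModel (K := K) h₂.1
  obtain ⟨τ, hτ, k', _, _, _, red', hred'⟩ := exists_frobeniusModel (K := K) h₃.1
  have hc : (factorsOfDegree ((intPoly n a).map (Int.castRingHom (ZMod l))) 0).card + 2 =
      Fintype.card ((ratPoly n a).rootSet K) := by
    have := (splitTypeOf_iff.1 h₃).2 ⟨0, by omega⟩
    simp only [quadraticType] at this
    rw [this, hcard]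
    simp
    omega
  have hswap := hred'.isSwap (hm.map _).ne_zero hc
  have hfix : ∃ x₀, σ x₀ = x₀ ∧ ∀ y z, y ≠ x₀ → z ≠ x₀ → ∃ j : ℕ, (σ ^ j) y = z := by
    have := (splitTypeOf_iff.1 h₂).2 ⟨n - 2, by omega⟩
    have hpos : 0 < (factorsOfDegree ((intPoly n a).map (Int.castRingHom (ZMod q)))
        (n - 2)).card := by
      rw [this]
      simp only [linearIrredType]
      rw [if_pos (show n - 2 + 2 = n by omega)]
      omega
    obtain ⟨g, hg⟩ := card_pos.1 hpos
    refine hred.exists_fixed (hm.map _) (n := n - 1) ?_ (q := g) ?_ (by omega)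
    · rw [hm.natDegree_map, intPoly_natDegree]; omega
    · rwa [show n - 1 - 1 = n - 2 by omega]
  obtain ⟨x₀, hx₀, hcyc⟩ := hfix
  have htrans := Gal.galAction_isPretransitive (ratPoly n a) K hirr
  have htop : (Gal.galActionHom (ratPoly n a) K).range = ⊤ := by
    refine subgroup_eq_top_of_isSwap_mem _ (fun x y => ?_) hσ hcyc hx₀ hτ hswap
    obtain ⟨g, hg⟩ := htrans.exists_smul_eq x y
    exact ⟨_, ⟨g, rfl⟩, hg⟩
  have e1 := MulEquiv.ofBijective (Gal.galActionHom (ratPoly n a) K)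
    ⟨Gal.galActionHom_injective _ _, MonoidHom.range_eq_top.1 htop⟩
  have e2 : (ratPoly n a).rootSet K ≃ Fin n := Fintype.equivFinOfCardEq hcard
  exact ⟨e1.trans e2.permCongrHom⟩

lemma isSplittingField_rat (F : Polynomial ℚ) :
    IsSplittingField ℚ F.SplittingField F := by
  convert IsSplittingField.splittingField F
  exact Subsingleton.elim _ _

/-- A polynomial with suitable splitting types at three primes has symmetric Galois group. -/
lemma isSnPoly_of_hasSplitType {n : ℕ} (hn : 2 ≤ n) {a : Fin n → ℤ} {p q l : ℕ} (hp : p.Prime)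
    (hq : q.Prime) (hl : l.Prime) (h₁ : HasSplitType n (irredType n) a p)
    (h₂ : HasSplitType n (linearIrredType n) a q) (h₃ : HasSplitType n (quadraticType n) a l) :
    IsSnPoly n a := by
  have : Fact p.Prime := ⟨hp⟩
  have : Fact q.Prime := ⟨hq⟩
  have : Fact l.Prime := ⟨hl⟩
  have hirr := irreducible_of_irredType hn h₁
  have hsf := isSplittingField_rat (ratPoly n a)
  have : IsGalois ℚ (ratPoly n a).SplittingField :=
    IsGalois.of_separable_splitting_field hirr.separable
  have : NumberField (ratPoly n a).SplittingField :=
    { to_finiteDimensional := IsSplittingField.finiteDimensional _ (ratPoly n a) }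
  have : Fact ((ratPoly n a).map (algebraMap ℚ (ratPoly n a).SplittingField)).Splits :=
    ⟨hsf.splits⟩
  exact nonempty_gal_mulEquiv_perm (K := (ratPoly n a).SplittingField) hn hirr h₂ h₃

lemma sum_irredType {n : ℕ} (hn : 2 ≤ n) :
    ∑ i : Fin n, ((i : ℕ) + 1) * irredType n i = n := by
  rw [Finset.sum_eq_single ⟨n - 1, by omega⟩]
  · simp only [irredType]
    rw [if_pos (by omega)]
    omega
  · intro i _ hi
    have : (i : ℕ) + 1 ≠ n := fun h => hi (Fin.ext (by simp; omega))
    simp [irredType, this]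
  · simp

lemma sum_linearIrredType {n : ℕ} (hn : 2 ≤ n) :
    ∑ i : Fin n, ((i : ℕ) + 1) * linearIrredType n i = n := by
  simp only [linearIrredType, mul_add, sum_add_distrib]
  rw [Finset.sum_eq_single ⟨0, by omega⟩, Finset.sum_eq_single ⟨n - 2, by omega⟩]
  · simp only
    rw [if_pos trivial, if_pos (show n - 2 + 2 = n by omega)]
    omega
  · intro i _ hi
    have : (i : ℕ) + 2 ≠ n := fun h => hi (Fin.ext (by simp; omega))
    simp [this]
  · simp
  · intro i _ hi
    have : (i : ℕ) ≠ 0 := fun h => hi (Fin.ext (by simp; omega))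
    simp [this]
  · simp

lemma sum_quadraticType {n : ℕ} (hn : 2 ≤ n) :
    ∑ i : Fin n, ((i : ℕ) + 1) * quadraticType n i = n := by
  simp only [quadraticType, mul_add, sum_add_distrib]
  rw [Finset.sum_eq_single ⟨0, by omega⟩, Finset.sum_eq_single ⟨1, by omega⟩]
  · simp
    omega
  · intro i _ hi
    have : (i : ℕ) ≠ 1 := fun h => hi (Fin.ext (by simp; omega))
    simp [this]
  · simp
  · intro i _ hi
    have : (i : ℕ) ≠ 0 := fun h => hi (Fin.ext (by simp; omega))
    simp [this]
  · simp

/-- The primes up to `m`. -/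
def primesUpTo (m : ℕ) : Finset ℕ := (range (m + 1)).filter Nat.Prime

lemma mem_primesUpTo {m p : ℕ} : p ∈ primesUpTo m ↔ p ≤ m ∧ p.Prime := by
  simp [primesUpTo]

lemma primesUpTo_mono {m m' : ℕ} (h : m ≤ m') : primesUpTo m ⊆ primesUpTo m' := fun p hp => by
  rw [mem_primesUpTo] at hp ⊢
  exact ⟨hp.1.trans h, hp.2⟩

lemma sum_inv_primes_dyadic {J : ℕ} (hJ : 1 ≤ J) :
    ∑ p ∈ primesUpTo (2 ^ (J + 1)) \ primesUpTo (2 ^ J), (1 : ℝ) / p ≤ 4 / J := by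
  have hl2 : 0 < Real.log 2 := Real.log_pos one_lt_two
  have hJ0 : (0 : ℝ) < J := by exact_mod_cast hJ
  have hterm : ∀ p ∈ primesUpTo (2 ^ (J + 1)) \ primesUpTo (2 ^ J),
      (1 : ℝ) / p ≤ Real.log p / (J * Real.log 2 * 2 ^ J) := by
    intro p hp
    rw [Finset.mem_sdiff, mem_primesUpTo, mem_primesUpTo] at hp
    obtain ⟨⟨h1, h2⟩, h3⟩ := hp
    have h4 : (2 : ℝ) ^ J ≤ p := by
      have : 2 ^ J ≤ p := by
        by_contra h
        exact h3 ⟨by omega, h2⟩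
      exact_mod_cast this
    have h5 : J * Real.log 2 ≤ Real.log p := by
      rw [← Real.log_pow]
      exact Real.log_le_log (by positivity) h4
    have h6 : (0 : ℝ) < p := by exact_mod_cast h2.pos
    rw [div_le_div_iff₀ h6 (by positivity)]
    calc 1 * (J * Real.log 2 * 2 ^ J) ≤ Real.log p * p := by
          rw [one_mul]; gcongr
      _ = _ := rfl
  refine (sum_le_sum hterm).trans ?_
  rw [← sum_div, div_le_div_iff₀ (by positivity) hJ0]
  have hth : ∑ p ∈ primesUpTo (2 ^ (J + 1)) \ primesUpTo (2 ^ J), Real.log p ≤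
      Real.log 4 * 2 ^ (J + 1) := by
    have h := Chebyshev.theta_le_log4_mul_x (x := ((2 ^ (J + 1) : ℕ) : ℝ)) (by positivity)
    rw [Chebyshev.theta_eq_sum_primesLE_log] at h
    refine le_trans ?_ (h.trans_eq (by push_cast; rfl))
    refine sum_le_sum_of_subset_of_nonneg ?_ fun p _ _ => Real.log_natCast_nonneg p
    intro p hp
    rw [Finset.mem_sdiff, mem_primesUpTo] at hp
    rw [Nat.mem_primesLE]
    exact hp.1
  have h4 : Real.log 4 = 2 * Real.log 2 := by
    rw [show (4 : ℝ) = 2 ^ 2 by norm_num, Real.log_pow]; norm_num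
  rw [h4] at hth
  calc _ ≤ (2 * Real.log 2 * 2 ^ (J + 1)) * J := by gcongr
    _ = _ := by rw [pow_succ]; ring

lemma sum_inv_primes_two_pow_le (J : ℕ) :
    ∑ p ∈ primesUpTo (2 ^ (J + 1)), (1 : ℝ) / p ≤ 1 + 4 * (harmonic J : ℝ) := by
  induction J with
  | zero =>
    have : primesUpTo (2 ^ (0 + 1)) = {2} := by
      ext p
      rw [mem_primesUpTo, mem_singleton]
      constructor
      · rintro ⟨h1, h2⟩
        exact le_antisymm h1 h2.two_le
      · rintro rfl
        exact ⟨le_rfl, Nat.prime_two⟩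
    rw [this]
    norm_num
  | succ J ih =>
    rw [← sum_sdiff (primesUpTo_mono (Nat.pow_le_pow_right two_pos (Nat.le_succ (J + 1)))),
      harmonic_succ]
    have := sum_inv_primes_dyadic (Nat.le_add_left 1 J)
    push_cast at this ⊢
    rw [div_eq_mul_inv] at this
    linarith

lemma sum_inv_primes_le {x : ℝ} (hx : 3 ≤ x) :
    ∑ p ∈ primesUpTo ⌊x⌋₊, (1 : ℝ) / p ≤ 13 + 4 * Real.log (Real.log x) := by
  set m := ⌊x⌋₊
  set J := Nat.log 2 m
  have hm3 : 3 ≤ m := Nat.le_floor (by exact_mod_cast hx)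
  have hmx : (m : ℝ) ≤ x := Nat.floor_le (by linarith)
  have h1 : m ≤ 2 ^ (J + 1) := (Nat.lt_pow_succ_log_self one_lt_two m).le
  have hlogx : 1 ≤ Real.log x := by
    rw [Real.le_log_iff_exp_le (by linarith)]
    linarith [Real.exp_one_lt_three]
  have hJ : (J : ℝ) ≤ 2 * Real.log x := by
    have h2 : (2 : ℝ) ^ J ≤ m := by exact_mod_cast Nat.pow_log_le_self 2 (by omega)
    have h3 : J * Real.log 2 ≤ Real.log x := by
      rw [← Real.log_pow]
      exact Real.log_le_log (by positivity) (h2.trans hmx)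
    have := Real.log_two_gt_d9
    have hJ0 : (0 : ℝ) ≤ J := Nat.cast_nonneg _
    nlinarith
  have hJ1 : 1 ≤ J := Nat.log_pos one_lt_two (by omega)
  have hlogJ : Real.log J ≤ 2 + Real.log (Real.log x) := by
    have h5 := Real.log_le_log (by exact_mod_cast hJ1) hJ
    rw [Real.log_mul two_ne_zero (by linarith)] at h5
    linarith [Real.log_two_lt_d9]
  have h6 := harmonic_le_one_add_log J
  have h7 := sum_inv_primes_two_pow_le J
  have h8 : ∑ p ∈ primesUpTo m, (1 : ℝ) / p ≤ ∑ p ∈ primesUpTo (2 ^ (J + 1)), (1 : ℝ) / p :=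
    sum_le_sum_of_subset_of_nonneg (primesUpTo_mono h1) fun p _ _ => by positivity
  linarith

lemma primePi_eq_primeCounting (x : ℝ) : primePi x = Nat.primeCounting ⌊x⌋₊ := by
  rw [← Nat.primesLE_card_eq_primeCounting, primePi]
  congr 1

lemma primePi_le {x : ℝ} (hx : 0 ≤ x) : (primePi x : ℝ) ≤ x := by
  refine le_trans ?_ (Nat.floor_le hx)
  have : primePi x ≤ ((range (⌊x⌋₊ + 1)).erase 0).card := by
    refine card_le_card fun p hp => ?_
    rw [mem_filter] at hp
    exact mem_erase.2 ⟨hp.2.ne_zero, hp.1⟩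
  rw [card_erase_of_mem (by simp), card_range] at this
  exact_mod_cast this

lemma eventually_sqrt_le_primePi : ∀ᶠ x : ℝ in atTop, Real.sqrt x ≤ primePi x := by
  have h := (isLittleO_log_rpow_atTop (r := 1 / 2) (by norm_num)).bound
    (show (0 : ℝ) < 1 / 10 by norm_num)
  filter_upwards [h, eventually_ge_atTop (100 : ℝ)] with x hx hx100
  rw [Real.norm_of_nonneg (Real.log_nonneg (by linarith)),
    Real.norm_of_nonneg (by positivity), ← Real.sqrt_eq_rpow] at hx
  rw [primePi_eq_primeCounting]
  refine le_trans ?_ (Chebyshev.pi_ge' (by linarith))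
  rw [le_div_iff₀ (Real.log_pos (by linarith))]
  have hs : Real.sqrt x * Real.sqrt x = x := Real.mul_self_sqrt (by linarith)
  have hs0 := Real.sqrt_nonneg x
  have h1 : Real.sqrt x * Real.log x ≤ x / 10 := by nlinarith
  have h2 : Real.log (x + 2) ≤ 2 * Real.log x := by
    have := Real.log_le_log (show 0 < x + 2 by linarith) (show x + 2 ≤ x ^ 2 by nlinarith)
    rwa [Real.log_pow] at this
  have h3 : Real.sqrt x ≤ x := by
    rw [Real.sqrt_le_left (by linarith)]; nlinarith
  have := Real.log_two_gt_d9
  nlinarith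

lemma tendsto_log_log_atTop : Tendsto (fun x : ℝ => Real.log (Real.log x)) atTop atTop :=
  Real.tendsto_log_atTop.comp Real.tendsto_log_atTop

lemma eventually_mul_log_pow_le_primePi {c : ℝ} (hc : 0 ≤ c) (j : ℕ) :
    ∀ᶠ x : ℝ in atTop, c * Real.log x ^ j ≤ primePi x := by
  have h := (isLittleO_log_rpow_rpow_atTop (s := 1 / 2) j (by norm_num)).bound
    (show (0 : ℝ) < 1 / (c + 1) by positivity)
  filter_upwards [h, eventually_ge_atTop (3 : ℝ), eventually_sqrt_le_primePi] with x hx hx3 hpi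
  have hlog : 0 ≤ Real.log x := Real.log_nonneg (by linarith)
  rw [Real.rpow_natCast, Real.norm_of_nonneg (by positivity), Real.norm_of_nonneg (by positivity),
    ← Real.sqrt_eq_rpow, div_mul_eq_mul_div, one_mul, le_div_iff₀ (by positivity)] at hx
  have : 0 ≤ Real.log x ^ j := by positivity
  linarith

/-- Moments of the sum of the independent model variables over the primes up to `x`. -/
lemma exists_abs_sumMoment_le {n : ℕ} {r : Fin n → ℕ}
    (hr : ∑ i : Fin n, ((i : ℕ) + 1) * r i = n) :
    ∃ A ≥ (1 : ℝ), ∀ᶠ x : ℝ in atTop, ∀ k : ℕ,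
      |sumMoment (devMoment n r) (primesUpTo ⌊x⌋₊) k| ≤
        k.factorial * majorant (A * Real.log (Real.log x)) (splitDelta n r * primePi x) k := by
  obtain ⟨B, hB, happ⟩ := primeApprox_typeDensity hr
  have hδ := splitDelta_pos n r
  refine ⟨17 * B + 1, by linarith, ?_⟩
  filter_upwards [eventually_mul_log_pow_le_primePi (show 0 ≤ 17 * B / splitDelta n r ^ 2 by positivity) 1,
    eventually_ge_atTop (3 : ℝ), tendsto_log_log_atTop.eventually_ge_atTop 1] with x hx hx3 hll k
  have hS := sum_inv_primes_le hx3
  have hlog : 0 ≤ Real.log x := Real.log_nonneg (by linarith)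
  rw [pow_one, div_mul_eq_mul_div, div_le_iff₀ (by positivity)] at hx
  have hle := Real.log_le_self hlog
  set S := ∑ p ∈ primesUpTo ⌊x⌋₊, (1 : ℝ) / p
  set ℓ := Real.log (Real.log x)
  have hSℓ : S ≤ 17 * ℓ := by linarith
  have hBS : B * S ≤ 17 * B * ℓ := by nlinarith
  have hdev : ∀ p ∈ primesUpTo ⌊x⌋₊,
      |typeDensity n r p - splitDelta n r| ≤ B * (1 / p) := by
    intro p hp
    rw [mul_one_div]
    exact happ p (mem_primesUpTo.1 hp).2
  refine abs_sumMoment_le (v := fun p => devMoment n r p 2) _ (fun p hp => ?_)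
    (fun p hp j hj => ?_) ?_ ?_ k
  · have : NeZero p := ⟨(mem_primesUpTo.1 hp).2.ne_zero⟩
    exact devMoment_zero n r p
  · have : NeZero p := ⟨(mem_primesUpTo.1 hp).2.ne_zero⟩
    exact abs_devMoment_le n r p hj
  · calc ∑ p ∈ primesUpTo ⌊x⌋₊, |devMoment n r p 1|
        ≤ ∑ p ∈ primesUpTo ⌊x⌋₊, B * (1 / (p : ℝ)) := by
          refine sum_le_sum fun p hp => ?_
          have : NeZero p := ⟨(mem_primesUpTo.1 hp).2.ne_zero⟩
          rw [devMoment_one]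
          exact hdev p hp
      _ = B * S := by rw [mul_sum]
      _ ≤ (17 * B + 1) * ℓ := by nlinarith
  · calc ∑ p ∈ primesUpTo ⌊x⌋₊, devMoment n r p 2
        ≤ ∑ p ∈ primesUpTo ⌊x⌋₊, (splitDelta n r - splitDelta n r ^ 2 + B * (1 / (p : ℝ))) := by
          refine sum_le_sum fun p hp => ?_
          have : NeZero p := ⟨(mem_primesUpTo.1 hp).2.ne_zero⟩
          exact (devMoment_two_le n r p).trans (by linarith [hdev p hp])
      _ = primePi x * (splitDelta n r - splitDelta n r ^ 2) + B * S := by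
          rw [sum_add_distrib, sum_const, nsmul_eq_mul, mul_sum]
          rfl
      _ ≤ splitDelta n r * primePi x := by
          have : 17 * B * ℓ ≤ 17 * B * Real.log x := by gcongr
          linarith

lemma card_coeffBox_pos (n N : ℕ) : (0 : ℝ) < (coeffBox n N).card := by
  rw [card_coeffBox]
  positivity

lemma abs_sum_box_countSplit_le (n : ℕ) (r : Fin n → ℕ) {x : ℝ} (hx : 1 ≤ x) {k N : ℕ}
    (hxN : x ^ (2 * k) ≤ N) :
    |∑ a ∈ coeffBox n N, ((countSplit n r a x : ℝ) - splitDelta n r * primePi x) ^ k| ≤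
      (|sumMoment (devMoment n r) (primesUpTo ⌊x⌋₊) k| + n * 2 ^ n) * (coeffBox n N).card := by
  have hfl : (⌊x⌋₊ : ℝ) ≤ x := Nat.floor_le (by linarith)
  have hpi : (primePi x : ℝ) ≤ x := primePi_le (by linarith)
  have hy : (⌊x⌋₊ : ℝ) ^ k ≤ N :=
    (pow_le_pow_left₀ (by positivity) hfl k).trans
      ((pow_le_pow_right₀ hx (by omega)).trans hxN)
  have h := abs_sum_box_pow_sub_le n r (P := primesUpTo ⌊x⌋₊) (y := ⌊x⌋₊) (k := k) (N := N)
    (fun p hp => (mem_primesUpTo.1 hp).2) (Nat.le_floor (by exact_mod_cast hx))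
    (fun p hp => (mem_primesUpTo.1 hp).1) (by
      have : ⌊x⌋₊ ^ k ≤ N := by exact_mod_cast hy
      omega)
  rw [← card_coeffBox] at h
  simp_rw [countSplit_sub_eq_sum]
  have hc := card_coeffBox_pos n N
  have herr : (primePi x : ℝ) ^ k * (n * 2 ^ n * (⌊x⌋₊ : ℝ) ^ k * (coeffBox n N).card /
      (2 * N + 1)) ≤ n * 2 ^ n * (coeffBox n N).card := by
    rw [mul_div_assoc', div_le_iff₀ (by positivity)]
    have h1 : (primePi x : ℝ) ^ k * (⌊x⌋₊ : ℝ) ^ k ≤ 2 * N + 1 := by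
      calc (primePi x : ℝ) ^ k * (⌊x⌋₊ : ℝ) ^ k ≤ x ^ k * x ^ k := by gcongr
        _ = x ^ (2 * k) := by ring
        _ ≤ 2 * N + 1 := by linarith [Nat.cast_nonneg (α := ℝ) N]
    calc _ = n * 2 ^ n * (coeffBox n N).card * ((primePi x : ℝ) ^ k * (⌊x⌋₊ : ℝ) ^ k) := by ring
      _ ≤ _ := by gcongr
  have h2 := h.trans herr
  have h3 := abs_sub_abs_le_abs_sub
    (∑ a ∈ coeffBox n N, (∑ p ∈ primesUpTo ⌊x⌋₊, typeDev n r a p) ^ k)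
    (sumMoment (devMoment n r) (primesUpTo ⌊x⌋₊) k * (coeffBox n N).card)
  rw [abs_mul, Nat.abs_cast] at h3
  rw [add_mul]
  change |∑ a ∈ coeffBox n N, (∑ p ∈ primesUpTo ⌊x⌋₊, typeDev n r a p) ^ k| ≤ _
  linarith

/-- Few polynomials have splitting type `r` at no prime up to `y`. -/
lemma exists_card_countSplit_eq_zero_le {n : ℕ} {r : Fin n → ℕ}
    (hr : ∑ i : Fin n, ((i : ℕ) + 1) * r i = n) :
    ∃ B : ℝ, 0 ≤ B ∧ ∀ᶠ y : ℝ in atTop, ∀ N : ℕ, y ^ 4 ≤ N →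
      (((coeffBox n N).filter fun a => countSplit n r a y = 0).card : ℝ) ≤
        B / Real.sqrt y * (coeffBox n N).card := by
  obtain ⟨A, hA, hmom⟩ := exists_abs_sumMoment_le hr
  have hδ := splitDelta_pos n r
  have hδ1 := splitDelta_le_one n r
  refine ⟨(2 + n * 2 ^ n) / splitDelta n r ^ 2, by positivity, ?_⟩
  filter_upwards [hmom, eventually_mul_log_pow_le_primePi (show 0 ≤ A ^ 2 by positivity) 2,
    eventually_sqrt_le_primePi, eventually_ge_atTop (3 : ℝ),
    tendsto_log_log_atTop.eventually_ge_atTop 0] with y hy hlog hsq hy3 hll N hN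
  have hsqrt : 1 ≤ Real.sqrt y := Real.one_le_sqrt.2 (by linarith)
  set π := (primePi y : ℝ) with hπ
  have hπ0 : 0 < π := by linarith
  have hbox := abs_sum_box_countSplit_le n r (x := y) (k := 2) (N := N) (by linarith) (by simpa)
  have hmaj := hy 2
  have hlogy : 0 ≤ Real.log y := Real.log_nonneg (by linarith)
  rw [show ((2 : ℕ).factorial : ℝ) = 2 by norm_num, majorant_two] at hmaj
  have hL : (A * Real.log (Real.log y)) ^ 2 ≤ π := by
    rw [mul_pow]
    refine le_trans ?_ hlog
    exact mul_le_mul_of_nonneg_left (pow_le_pow_left₀ hll (Real.log_le_self hlogy) 2)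
      (by positivity)
  have hV : splitDelta n r * π ≤ π := by nlinarith
  have hc := card_coeffBox_pos n N
  have hbound : (|sumMoment (devMoment n r) (primesUpTo ⌊y⌋₊) 2| + n * 2 ^ n) ≤
      (2 + n * 2 ^ n) * π := by
    have : (n : ℝ) * 2 ^ n ≤ n * 2 ^ n * π := le_mul_of_one_le_right (by positivity) (by linarith)
    linarith
  have hlow : (((coeffBox n N).filter fun a => countSplit n r a y = 0).card : ℝ) *
      (splitDelta n r * π) ^ 2 ≤
      ∑ a ∈ coeffBox n N, ((countSplit n r a y : ℝ) - splitDelta n r * π) ^ 2 := by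
    rw [← nsmul_eq_mul, ← sum_const]
    calc _ = ∑ a ∈ (coeffBox n N).filter fun a => countSplit n r a y = 0,
          ((countSplit n r a y : ℝ) - splitDelta n r * π) ^ 2 := by
          refine sum_congr rfl fun a ha => ?_
          rw [(mem_filter.1 ha).2]
          simp
      _ ≤ _ := sum_le_sum_of_subset_of_nonneg (filter_subset _ _) fun a _ _ => sq_nonneg _
  set Z := (((coeffBox n N).filter fun a => countSplit n r a y = 0).card : ℝ)
  have h1 : Z * (splitDelta n r * π) ^ 2 ≤ (2 + n * 2 ^ n) * π * (coeffBox n N).card :=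
    hlow.trans ((le_abs_self _).trans (hbox.trans (by gcongr)))
  have h2 : Z ≤ (2 + n * 2 ^ n) / splitDelta n r ^ 2 / π * (coeffBox n N).card := by
    have h3 : Z ≤ (2 + n * 2 ^ n) * π * (coeffBox n N).card / (splitDelta n r * π) ^ 2 := by
      rwa [le_div_iff₀ (by positivity)]
    refine h3.trans_eq ?_
    field_simp
  refine h2.trans ?_
  gcongr

lemma exists_hasSplitType_of_countSplit_ne_zero {n : ℕ} {r : Fin n → ℕ} {a : Fin n → ℤ} {y : ℝ}
    (h : countSplit n r a y ≠ 0) : ∃ p, p.Prime ∧ HasSplitType n r a p := by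
  obtain ⟨p, hp⟩ := card_pos.1 (Nat.pos_of_ne_zero h)
  exact ⟨p, (mem_filter.1 hp).2⟩

/-- Few polynomials are not `S_n`-polynomials. -/
lemma exists_card_not_isSnPoly_le {n : ℕ} (hn : 2 ≤ n) :
    ∃ B : ℝ, 0 ≤ B ∧ ∀ᶠ y : ℝ in atTop, ∀ N : ℕ, y ^ 4 ≤ N →
      ((coeffBox n N \ P0 n N).card : ℝ) ≤ B / Real.sqrt y * (coeffBox n N).card := by
  obtain ⟨B₁, hB₁, h₁⟩ := exists_card_countSplit_eq_zero_le (sum_irredType hn)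
  obtain ⟨B₂, hB₂, h₂⟩ := exists_card_countSplit_eq_zero_le (sum_linearIrredType hn)
  obtain ⟨B₃, hB₃, h₃⟩ := exists_card_countSplit_eq_zero_le (sum_quadraticType hn)
  refine ⟨B₁ + B₂ + B₃, by positivity, ?_⟩
  filter_upwards [h₁, h₂, h₃] with y h₁ h₂ h₃ N hN
  have hsub : coeffBox n N \ P0 n N ⊆
      ((coeffBox n N).filter fun a => countSplit n (irredType n) a y = 0) ∪
      ((coeffBox n N).filter fun a => countSplit n (linearIrredType n) a y = 0) ∪
      ((coeffBox n N).filter fun a => countSplit n (quadraticType n) a y = 0) := by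
    intro a ha
    rw [Finset.mem_sdiff, P0, mem_filter] at ha
    obtain ⟨ha, hS⟩ := ha
    by_contra hcon
    simp only [mem_union, mem_filter, ha, true_and, not_or] at hcon
    obtain ⟨⟨c1, c2⟩, c3⟩ := hcon
    obtain ⟨p, hp, hp'⟩ := exists_hasSplitType_of_countSplit_ne_zero c1
    obtain ⟨q, hq, hq'⟩ := exists_hasSplitType_of_countSplit_ne_zero c2
    obtain ⟨l, hl, hl'⟩ := exists_hasSplitType_of_countSplit_ne_zero c3
    exact hS ⟨ha, isSnPoly_of_hasSplitType hn hp hq hl hp' hq' hl'⟩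
  have hcard := (card_le_card hsub).trans ((card_union_le _ _).trans
    (Nat.add_le_add_right (card_union_le _ _) _))
  have hcard' := Nat.cast_le (α := ℝ).2 hcard
  push_cast at hcard'
  rw [add_div, add_div, add_mul, add_mul]
  linarith [h₁ N hN, h₂ N hN, h₃ N hN]

lemma eventually_log_log_le_log_rpow :
    ∀ᶠ t : ℝ in atTop, Real.log (Real.log t) ≤ Real.log (t ^ (1 / Real.log (Real.log t))) := by
  have h := (isLittleO_log_rpow_rpow_atTop (s := 1) 2 (by norm_num)).bound one_pos
  filter_upwards [Real.tendsto_log_atTop.eventually h, eventually_gt_atTop (1 : ℝ),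
    tendsto_log_log_atTop.eventually_gt_atTop 0] with t ht ht1 hll
  have hlog : 0 < Real.log t := Real.log_pos ht1
  rw [Real.rpow_one, one_mul, Real.norm_of_nonneg (by positivity),
    Real.norm_of_nonneg hlog.le] at ht
  rw [Real.log_rpow (by linarith), one_div, ← div_eq_inv_mul, le_div_iff₀ hll, ← sq]
  exact_mod_cast ht

lemma tendsto_rpow_one_div_log_log :
    Tendsto (fun t : ℝ => t ^ (1 / Real.log (Real.log t))) atTop atTop := by
  refine tendsto_atTop_mono' _ ?_ Real.tendsto_log_atTop
  filter_upwards [eventually_log_log_le_log_rpow, eventually_gt_atTop (1 : ℝ)] with t ht ht1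
  have hlog : 0 < Real.log t := Real.log_pos ht1
  rwa [Real.log_le_log_iff hlog (by positivity)] at ht

lemma rpow_one_div_log_log_pow_le {t : ℝ} (ht : 1 ≤ t) (hll : 0 < Real.log (Real.log t)) {k : ℕ}
    {c : ℝ} (hk : (k : ℝ) ≤ c * Real.log (Real.log t)) :
    (t ^ (1 / Real.log (Real.log t))) ^ k ≤ t ^ c := by
  rw [← Real.rpow_mul_natCast (by linarith)]
  refine Real.rpow_le_rpow_of_exponent_le ht ?_
  rwa [one_div, ← div_eq_inv_mul, div_le_iff₀ hll]

lemma CkrOdd_mul_pow (n : ℕ) (r : Fin n → ℕ) (m : ℕ) (y : ℝ) :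
    CkrOdd n r (2 * m + 1) * y ^ m =
      (2 * m + 1).factorial * gaussCoeff (splitDelta n r * y) m := by
  rw [CkrOdd, gaussCoeff, show (2 * m + 1 - 1) / 2 = m by omega, mul_pow]
  ring

lemma one_le_factorial_mul_gaussCoeff {V : ℝ} (hV : 2 ≤ V) (m : ℕ) :
    1 ≤ (2 * m + 1).factorial * gaussCoeff V m := by
  have h1 : (m.factorial : ℝ) ≤ (2 * m + 1).factorial :=
    Nat.cast_le.2 (Nat.factorial_le (by omega))
  have h2 : (2 : ℝ) ^ m ≤ V ^ m := pow_le_pow_left₀ (by norm_num) hV m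
  rw [gaussCoeff, mul_div_assoc', le_div_iff₀ (by positivity), one_mul, mul_comm]
  gcongr

lemma abs_countSplit_sub_le (n : ℕ) (r : Fin n → ℕ) (a : Fin n → ℤ) (x : ℝ) :
    |(countSplit n r a x : ℝ) - splitDelta n r * primePi x| ≤ primePi x := by
  have h1 : (countSplit n r a x : ℝ) ≤ primePi x := by
    refine Nat.cast_le.2 (card_le_card fun p hp => ?_)
    rw [mem_filter] at hp ⊢
    exact ⟨hp.1, hp.2.1⟩
  have h2 := splitDelta_pos n r
  have h3 := splitDelta_le_one n r
  have h4 : (0 : ℝ) ≤ countSplit n r a x := Nat.cast_nonneg _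
  have h5 : (0 : ℝ) ≤ primePi x := Nat.cast_nonneg _
  rw [abs_le]
  constructor <;> nlinarith

/-- Passing from the box to the subfamily of `S_n`-polynomials. -/
lemma abs_expN_le {n N : ℕ} {F : (Fin n → ℤ) → ℝ} {ε M D : ℝ} (hD : 0 ≤ D) (hε : ε ≤ 1 / 2)
    (hF : ∀ a, |F a| ≤ D)
    (hc : ((coeffBox n N \ P0 n N).card : ℝ) ≤ ε * (coeffBox n N).card)
    (hM : |∑ a ∈ coeffBox n N, F a| ≤ M * (coeffBox n N).card) :
    |expN n N F| ≤ 2 * (M + D * ε) := by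
  have hsub : P0 n N ⊆ coeffBox n N := filter_subset _ _
  have hsum := sum_sdiff (f := F) hsub
  have hcard : ((coeffBox n N \ P0 n N).card : ℝ) + (P0 n N).card = (coeffBox n N).card := by
    exact_mod_cast card_sdiff_add_card_eq_card hsub
  have hpos := card_coeffBox_pos n N
  have hP : ((coeffBox n N).card : ℝ) ≤ 2 * (P0 n N).card := by nlinarith
  have hout : |∑ a ∈ coeffBox n N \ P0 n N, F a| ≤ D * (ε * (coeffBox n N).card) := by
    refine (abs_sum_le_sum_abs _ _).trans ((sum_le_sum fun a _ => hF a).trans ?_)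
    rw [sum_const, nsmul_eq_mul, mul_comm]
    gcongr
  have hin : |∑ a ∈ P0 n N, F a| ≤ (M + D * ε) * (coeffBox n N).card := by
    rw [← eq_sub_iff_add_eq'] at hsum
    rw [hsum]
    refine (abs_sub _ _).trans ?_
    linarith
  have hP0 : (0 : ℝ) < (P0 n N).card := by linarith
  have hMD : 0 ≤ M + D * ε := nonneg_of_mul_nonneg_left ((abs_nonneg _).trans hin) hpos
  rw [expN, abs_div, Nat.abs_cast, div_le_iff₀ hP0]
  nlinarith

/-- **Proposition 3.4, odd case**: with `x = N^{1/log log N}`, uniformly for odd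
`k ≪_{n,r} log log N`,
`𝔼_N((π_{f,r}(x) − δ(r)π(x))^k) ≪_{n,r} C_{k,r}·π(x)^{k/2}·k·(log log x)/π(x)^{1/2}`. -/
theorem central_moments_odd (n : ℕ) (hn : 2 ≤ n) (r : Fin n → ℕ)
    (hr : ∑ i : Fin n, ((i : ℕ) + 1) * r i = n) :
    ∃ c > (0 : ℝ), ∃ C > (0 : ℝ), ∃ N₀ : ℕ, ∀ N : ℕ, N₀ ≤ N → ∀ k : ℕ, Odd k →
      (k : ℝ) ≤ c * Real.log (Real.log (N : ℝ)) →
      |expN n N (fun f =>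
          ((countSplit n r f ((N : ℝ) ^ (1 / Real.log (Real.log (N : ℝ)))) : ℝ) -
            splitDelta n r *
              (primePi ((N : ℝ) ^ (1 / Real.log (Real.log (N : ℝ)))) : ℝ)) ^ k)| ≤
      C * CkrOdd n r k *
          (primePi ((N : ℝ) ^ (1 / Real.log (Real.log (N : ℝ)))) : ℝ) ^ ((k : ℝ) / 2) *
          (k : ℝ) *
          (Real.log (Real.log ((N : ℝ) ^ (1 / Real.log (Real.log (N : ℝ))))) /
            (primePi ((N : ℝ) ^ (1 / Real.log (Real.log (N : ℝ)))) : ℝ) ^ ((1 : ℝ) / 2)) := by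
  obtain ⟨A, hA, hmom⟩ := exists_abs_sumMoment_le hr
  obtain ⟨B, hB, hbad⟩ := exists_card_not_isSnPoly_le hn
  have hδ := splitDelta_pos n r
  refine ⟨1 / 8, by norm_num, 2 * (3 * A + n * 2 ^ n + B), by positivity, ?_⟩
  rw [← eventually_atTop (p := fun N : ℕ => ∀ k : ℕ, Odd k → _)]
  have hcast := tendsto_natCast_atTop_atTop (R := ℝ)
  have hx := tendsto_rpow_one_div_log_log.comp hcast
  have hy := (tendsto_rpow_atTop (show (0 : ℝ) < 1 / 4 by norm_num)).comp hcast
  have hy8 := (tendsto_rpow_atTop (show (0 : ℝ) < 1 / 8 by norm_num)).comp hcast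
  filter_upwards [hx.eventually hmom, hy.eventually hbad, hy8.eventually_ge_atTop (2 * B),
    hcast.eventually_ge_atTop 1, (tendsto_log_log_atTop.comp hcast).eventually_gt_atTop 0,
    hcast.eventually eventually_log_log_le_log_rpow,
    (tendsto_log_log_atTop.comp hx).eventually_ge_atTop 1,
    hx.eventually_ge_atTop 1,
    hx.eventually (eventually_mul_log_pow_le_primePi
      (show 0 ≤ 6 * A ^ 2 / splitDelta n r by positivity) 5),
    hx.eventually (eventually_mul_log_pow_le_primePi
      (show 0 ≤ 2 / splitDelta n r by positivity) 0)]
    with N hmom hbad hBN hN1 hll hllx hℓ hx1 hlog5 hlog0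
  rintro k ⟨m, rfl⟩ hk
  simp only [Function.comp_apply] at *
  have hxk := rpow_one_div_log_log_pow_le hN1 hll hk
  set t := (N : ℝ)
  set x := t ^ (1 / Real.log (Real.log t))
  set π := (primePi x : ℝ)
  set ℓ := Real.log (Real.log x)
  rw [div_mul_eq_mul_div, div_le_iff₀ hδ] at hlog5 hlog0
  rw [pow_zero, mul_one, mul_comm] at hlog0
  have hlogx : 0 ≤ Real.log x := Real.log_nonneg hx1
  have hπx : π ≤ x := primePi_le (by linarith)
  have hπ0 : 0 < π := by
    by_contra h
    nlinarith
  have hkx : (2 * m + 1 : ℝ) ≤ Real.log x := by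
    push_cast at hk
    linarith
  have hL : 1 ≤ A * ℓ := by nlinarith
  have hV : 6 * Real.log x ^ 3 * (A * ℓ) ^ 2 ≤ splitDelta n r * π := by
    have hℓ2 : ℓ ^ 2 ≤ Real.log x ^ 2 :=
      pow_le_pow_left₀ (by linarith) (Real.log_le_self hlogx) 2
    calc 6 * Real.log x ^ 3 * (A * ℓ) ^ 2 = 6 * A ^ 2 * Real.log x ^ 3 * ℓ ^ 2 := by ring
      _ ≤ 6 * A ^ 2 * Real.log x ^ 3 * Real.log x ^ 2 := by gcongr
      _ = 6 * A ^ 2 * Real.log x ^ 5 := by ring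
      _ ≤ _ := by linarith
  have hmaj := majorant_odd_le hL hV m hkx
  have hG1 := one_le_factorial_mul_gaussCoeff hlog0 m
  set G := ((2 * m + 1).factorial : ℝ) * gaussCoeff (splitDelta n r * π) m with hG
  have hk1 : (1 : ℝ) ≤ 2 * m + 1 := by linarith [Nat.cast_nonneg (α := ℝ) m]
  set H := G * (2 * m + 1) * ℓ with hH
  have hH1 : 1 ≤ H := by
    have : 1 ≤ G * (2 * m + 1) := by nlinarith
    nlinarith
  have hS : |sumMoment (devMoment n r) (primesUpTo ⌊x⌋₊) (2 * m + 1)| ≤ 3 * A * H := by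
    refine (hmom _).trans ?_
    calc _ ≤ ((2 * m + 1).factorial : ℝ) *
          (3 * (2 * m + 1) * (A * ℓ) * gaussCoeff (splitDelta n r * π) m) := by gcongr
      _ = 3 * A * H := by rw [hH, hG]; ring
  have hN2 : x ^ (2 * (2 * m + 1)) ≤ t := by
    rw [mul_comm, pow_mul]
    calc (x ^ (2 * m + 1)) ^ 2 ≤ (t ^ (1 / 8 : ℝ)) ^ 2 := by gcongr
      _ = t ^ (1 / 4 : ℝ) := by
        rw [← Real.rpow_mul_natCast (by linarith)]; norm_num
      _ ≤ t ^ (1 : ℝ) := Real.rpow_le_rpow_of_exponent_le hN1 (by norm_num)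
      _ = t := Real.rpow_one t
  have hbox := abs_sum_box_countSplit_le n r hx1 hN2
  have hy4 : (t ^ (1 / 4 : ℝ)) ^ 4 ≤ t := by
    rw [← Real.rpow_mul_natCast (by linarith)]; norm_num
  have hsqrt : Real.sqrt (t ^ (1 / 4 : ℝ)) = t ^ (1 / 8 : ℝ) := by
    rw [Real.sqrt_eq_rpow, ← Real.rpow_mul (by linarith)]; norm_num
  have hbadN := hbad N hy4
  rw [hsqrt] at hbadN
  have ht8 : 0 < t ^ (1 / 8 : ℝ) := Real.rpow_pos_of_pos (by linarith) _
  have hexp := abs_expN_le (D := x ^ (2 * m + 1)) (by positivity)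
    (by rw [div_le_iff₀ ht8]; linarith)
    (fun a => by
      rw [abs_pow]
      exact pow_le_pow_left₀ (abs_nonneg _) ((abs_countSplit_sub_le n r a x).trans hπx) _)
    hbadN hbox
  have hDε : x ^ (2 * m + 1) * (B / t ^ (1 / 8 : ℝ)) ≤ B := by
    rw [mul_div_assoc', div_le_iff₀ ht8, mul_comm]
    gcongr
  have hrhs : 2 * (3 * A + n * 2 ^ n + B) * CkrOdd n r (2 * m + 1) *
      π ^ (((2 * m + 1 : ℕ) : ℝ) / 2) * ((2 * m + 1 : ℕ) : ℝ) * (ℓ / π ^ ((1 : ℝ) / 2)) =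
      2 * (3 * A + n * 2 ^ n + B) * H := by
    have hpow : π ^ (((2 * m + 1 : ℕ) : ℝ) / 2) = π ^ m * π ^ ((1 : ℝ) / 2) := by
      rw [← Real.rpow_natCast, ← Real.rpow_add hπ0]
      congr 1
      push_cast
      ring
    have hhalf : π ^ ((1 : ℝ) / 2) ≠ 0 := (Real.rpow_pos_of_pos hπ0 _).ne'
    rw [hpow, hH, hG, ← CkrOdd_mul_pow]
    push_cast
    field_simp
  rw [hrhs]
  have hn2 : (0 : ℝ) ≤ n * 2 ^ n := by positivity
  nlinarith

end
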